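/- Let w ∈ A_1 and 0 < β ≤ 1. Then for every j ∈ ℕ and every f ∈ L^1_loc(ℝ^n), the varying-aperture intrinsic square function satisfies ‖S_{β,2^j}(f)‖_{L^2_w} ≤ C 2^{jn/2} ‖S_β(f)‖_{L^2_w}, with C independent of j and f. -/

import Mathlib

open MeasureTheory Metric Set

noncomputable section

/-- `ℝⁿ` as a Euclidean space. -/
abbrev Rn (n : ℕ) : Type := EuclideanSpace ℝ (Fin n)

variable {n : ℕ}

/-- Weighted measure of a set: `w(E) = ∫_E w`. -/
def wMeas (w : Rn n → ℝ) (s : Set (Rn n)) : ℝ := ∫ x in s, w x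

/-- The Muckenhoupt `A₁` condition with constant `C`. -/
def IsA1 (w : Rn n → ℝ) (C : ℝ) : Prop :=
  (∀ x, 0 ≤ w x) ∧ MeasureTheory.LocallyIntegrable w ∧
    ∀ (x₀ : Rn n) (R : ℝ), 0 < R →
      (∫ x in ball x₀ R, w x) ≤
        C * (volume (ball x₀ R)).toReal * essInf w (volume.restrict (ball x₀ R))

/-- The Muckenhoupt `A_p` condition (`1 < p`) with constant `C`. -/
def IsAp (w : Rn n → ℝ) (p C : ℝ) : Prop :=
  (∀ x, 0 ≤ w x) ∧ MeasureTheory.LocallyIntegrable w ∧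
    ∀ (x₀ : Rn n) (R : ℝ), 0 < R →
      ((volume (ball x₀ R)).toReal⁻¹ * ∫ x in ball x₀ R, w x) *
        ((volume (ball x₀ R)).toReal⁻¹ * ∫ x in ball x₀ R, (w x) ^ (-(1 / (p - 1)))) ^ (p - 1)
        ≤ C

/-- The reverse Hölder condition `RH_r` with constant `C`. -/
def IsRH (w : Rn n → ℝ) (r C : ℝ) : Prop :=
  ∀ (x₀ : Rn n) (R : ℝ), 0 < R →
    ((volume (ball x₀ R)).toReal⁻¹ * ∫ x in ball x₀ R, (w x) ^ r) ^ (1 / r) ≤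
      C * ((volume (ball x₀ R)).toReal⁻¹ * ∫ x in ball x₀ R, w x)

/-- The class `C_β`: support in the closed unit ball, mean zero, β-Hölder with constant 1. -/
def MemCbeta (β : ℝ) (φ : Rn n → ℝ) : Prop :=
  (∀ x, φ x ≠ 0 → ‖x‖ ≤ 1) ∧ MeasureTheory.Integrable φ ∧ (∫ x, φ x) = 0 ∧
    ∀ x x' : Rn n, |φ x - φ x'| ≤ ‖x - x'‖ ^ β

/-- Convolution `f * φ_t (x)` with the dilation `φ_t(x) = t^{-n} φ(x/t)`. -/
def convPhi (f φ : Rn n → ℝ) (t : ℝ) (x : Rn n) : ℝ :=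
  ∫ y, f y * (t ^ (-(n : ℝ)) * φ (t⁻¹ • (x - y)))

/-- The intrinsic averaging function `A_β(f)(y,t) = sup_{φ ∈ C_β} |f * φ_t(y)|`. -/
def Abeta (β : ℝ) (f : Rn n → ℝ) (y : Rn n) (t : ℝ) : ℝ :=
  ⨆ φ : {φ : Rn n → ℝ // MemCbeta β φ}, |convPhi f φ.1 t y|

/-- The intrinsic Littlewood–Paley `g`-function. -/
def gbeta (β : ℝ) (f : Rn n → ℝ) (x : Rn n) : ℝ :=
  (∫ t in Ioi (0 : ℝ), (Abeta β f x t) ^ 2 / t) ^ (1 / 2 : ℝ)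

/-- The intrinsic Lusin area function of aperture `γ`. -/
def SbetaA (β γ : ℝ) (f : Rn n → ℝ) (x : Rn n) : ℝ :=
  (∫ p in {p : Rn n × ℝ | dist x p.1 < γ * p.2 ∧ 0 < p.2},
      (Abeta β f p.1 p.2) ^ 2 / p.2 ^ (n + 1)) ^ (1 / 2 : ℝ)

/-- The intrinsic `g^*_λ` function. -/
def gstar (lam β : ℝ) (f : Rn n → ℝ) (x : Rn n) : ℝ :=
  (∫ p in {p : Rn n × ℝ | 0 < p.2},
      (p.2 / (p.2 + dist x p.1)) ^ (lam * (n : ℝ)) * (Abeta β f p.1 p.2) ^ 2 / p.2 ^ (n + 1)) ^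
    (1 / 2 : ℝ)

/-- The weighted `L^q` norm `(∫ |g|^q w)^{1/q}`. -/
def wLq (q : ℝ) (w g : Rn n → ℝ) : ℝ := (∫ x, |g x| ^ q * w x) ^ (1 / q)

/-- The weighted Hardy–Littlewood maximal operator. -/
def Mw (w b : Rn n → ℝ) (x : Rn n) : ℝ :=
  ⨆ B : {B : Rn n × ℝ // 0 < B.2 ∧ x ∈ ball B.1 B.2},
    (wMeas w (ball B.1.1 B.1.2))⁻¹ * ∫ y in ball B.1.1 B.1.2, |b y| * w y

/-- A central `(α, q, 0; w₁, w₂)`-atom supported in `B(0,R)`. -/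
def IsCentralAtom (α q R : ℝ) (w₁ w₂ a : Rn n → ℝ) : Prop :=
  MeasureTheory.Integrable a ∧ (∀ x, a x ≠ 0 → x ∈ ball (0 : Rn n) R) ∧
    wLq q w₂ a ≤ (wMeas w₁ (ball (0 : Rn n) R)) ^ (-(α / (n : ℝ))) ∧
    (∫ x, a x) = 0

/-- The homogeneous weighted Herz norm `‖f‖_{\dot K^{α,p}_q(w₁,w₂)}`. -/
def herzNorm (α p q : ℝ) (w₁ w₂ f : Rn n → ℝ) : ℝ :=
  (∑' k : ℤ,
      (wMeas w₁ (closedBall (0 : Rn n) ((2 : ℝ) ^ k))) ^ (α * p / (n : ℝ)) *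
        ((∫ x in closedBall (0 : Rn n) ((2 : ℝ) ^ k) \ closedBall (0 : Rn n) ((2 : ℝ) ^ (k - 1)),
            |f x| ^ q * w₂ x) ^ (1 / q)) ^ p) ^ (1 / p)


/-! ### Test functions and their dilates -/

lemma MemCbeta.zero (β : ℝ) : MemCbeta β (0 : Rn n → ℝ) :=
  ⟨by simp, integrable_zero _ _ _, by simp, fun x x' => by
    simpa using Real.rpow_nonneg (norm_nonneg (x - x')) β⟩

lemma MemCbeta.continuous {β : ℝ} (hβ : 0 < β) {φ : Rn n → ℝ} (h : MemCbeta β φ) :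
    Continuous φ := by
  rw [continuous_iff_continuousAt]
  intro a
  rw [ContinuousAt, tendsto_iff_norm_sub_tendsto_zero]
  refine squeeze_zero (fun _ => norm_nonneg _) (fun x => h.2.2.2 x a) ?_
  have : Continuous fun x : Rn n => ‖x - a‖ ^ β :=
    (continuous_id.sub continuous_const).norm.rpow_const fun _ => Or.inr hβ.le
  simpa [Real.zero_rpow hβ.ne'] using this.tendsto a

lemma MemCbeta.abs_le {β : ℝ} (hβ : 0 < β) (hβ1 : β ≤ 1) {φ : Rn n → ℝ} (h : MemCbeta β φ)
    (x : Rn n) : |φ x| ≤ 2 := by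
  by_cases hx : φ x = 0
  · simp [hx]
  have hx1 := h.1 x hx
  set B : Set (Rn n) := closedBall 0 1
  have hB : 0 < volume.real B :=
    ENNReal.toReal_pos (measure_closedBall_pos volume _ one_pos).ne' measure_closedBall_lt_top.ne
  have h0 : ∫ y in B, φ y = 0 := by
    rw [setIntegral_eq_integral_of_forall_compl_eq_zero, h.2.2.1]
    intro y hy
    by_contra hne
    exact hy (by simpa [B] using h.1 y hne)
  have h1 : ∫ y in B, (φ x - φ y) = volume.real B * φ x := by
    have hc : IntegrableOn (fun _ => φ x) B volume :=
      integrableOn_const measure_closedBall_lt_top.ne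
    rw [integral_sub hc h.2.1.integrableOn, h0]
    simp
  have h2 : ‖∫ y in B, (φ x - φ y)‖ ≤ 2 * volume.real B := by
    refine norm_setIntegral_le_of_norm_le_const measure_closedBall_lt_top fun y hy => ?_
    refine (h.2.2.2 x y).trans ?_
    have hxy : ‖x - y‖ ≤ 2 := by
      have : ‖y‖ ≤ 1 := by simpa [B] using hy
      linarith [norm_sub_le x y]
    calc ‖x - y‖ ^ β ≤ 2 ^ β := Real.rpow_le_rpow (norm_nonneg _) hxy hβ.le
      _ ≤ 2 ^ (1 : ℝ) := Real.rpow_le_rpow_of_exponent_le (by norm_num) hβ1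
      _ = 2 := by simp
  rw [h1, Real.norm_eq_abs, abs_mul, abs_of_pos hB, mul_comm] at h2
  exact le_of_mul_le_mul_right h2 hB

/-- The kernel `u ↦ φ_s(q - u)`. -/
def bump (φ : Rn n → ℝ) (s : ℝ) (q u : Rn n) : ℝ := s ^ (-(n : ℝ)) * φ (s⁻¹ • (q - u))

lemma convPhi_eq (f φ : Rn n → ℝ) (t : ℝ) (x : Rn n) :
    convPhi f φ t x = ∫ u, f u * bump φ t x u := rfl

section bump

variable {β : ℝ} {φ : Rn n → ℝ} {s : ℝ}

lemma bump_support (h : MemCbeta β φ) (hs : 0 < s) {q u : Rn n} (hu : bump φ s q u ≠ 0) :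
    dist u q ≤ s := by
  have := h.1 _ (right_ne_zero_of_mul hu)
  rw [norm_smul, norm_inv, Real.norm_of_nonneg hs.le, inv_mul_le_iff₀ hs, mul_one] at this
  rwa [dist_comm, dist_eq_norm]

lemma bump_abs_le (hβ : 0 < β) (hβ1 : β ≤ 1) (h : MemCbeta β φ) (hs : 0 < s) (q u : Rn n) :
    |bump φ s q u| ≤ 2 * s ^ (-(n : ℝ)) := by
  have h0 := Real.rpow_nonneg hs.le (-(n : ℝ))
  rw [bump, abs_mul, abs_of_nonneg h0, mul_comm]
  exact mul_le_mul_of_nonneg_right (h.abs_le hβ hβ1 _) h0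

lemma bump_abs_sub_le (h : MemCbeta β φ) (hs : 0 < s) (q u u' : Rn n) :
    |bump φ s q u - bump φ s q u'| ≤ s ^ (-(n : ℝ)) * (dist u u' / s) ^ β := by
  have h0 := Real.rpow_nonneg hs.le (-(n : ℝ))
  rw [bump, bump, ← mul_sub, abs_mul, abs_of_nonneg h0]
  refine mul_le_mul_of_nonneg_left ((h.2.2.2 _ _).trans_eq ?_) h0
  rw [← smul_sub, sub_sub_sub_cancel_left, norm_smul, norm_inv, Real.norm_of_nonneg hs.le,
    ← dist_eq_norm, dist_comm, div_eq_inv_mul]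

lemma bump_continuous (hβ : 0 < β) (h : MemCbeta β φ) (s : ℝ) (q : Rn n) :
    Continuous (bump φ s q) :=
  continuous_const.mul ((h.continuous hβ).comp (by fun_prop))

lemma bump_hasCompactSupport (h : MemCbeta β φ) (hs : 0 < s) (q : Rn n) :
    HasCompactSupport (bump φ s q) :=
  HasCompactSupport.of_support_subset_isCompact (isCompact_closedBall q s)
    fun _ hu => bump_support h hs hu

lemma bump_integrable (hβ : 0 < β) (h : MemCbeta β φ) (hs : 0 < s) (q : Rn n) :
    Integrable (bump φ s q) :=
  (bump_continuous hβ h s q).integrable_of_hasCompactSupport (bump_hasCompactSupport h hs q)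

lemma integral_bump (h : MemCbeta β φ) (s : ℝ) (q : Rn n) : ∫ u, bump φ s q u = 0 := by
  unfold bump
  rw [integral_const_mul, integral_sub_left_eq_self (fun v => φ (s⁻¹ • v)) volume q,
    Measure.integral_comp_smul, h.2.2.1]
  simp

/-- The volume of the unit ball. -/
def unitVol (n : ℕ) : ℝ := volume.real (ball (0 : Rn n) 1)

lemma unitVol_pos (n : ℕ) : 0 < unitVol n :=
  ENNReal.toReal_pos (measure_ball_pos volume _ one_pos).ne' measure_ball_lt_top.ne

lemma volume_ball_eq (x : Rn n) {r : ℝ} (hr : 0 < r) :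
    volume (ball x r) = ENNReal.ofReal (unitVol n * r ^ n) := by
  rw [Measure.addHaar_ball_of_pos _ _ hr, finrank_euclideanSpace_fin, mul_comm,
    ENNReal.ofReal_mul (unitVol_pos n).le, unitVol, Measure.real,
    ENNReal.ofReal_toReal measure_ball_lt_top.ne]

lemma volume_real_ball_eq (x : Rn n) {r : ℝ} (hr : 0 < r) :
    volume.real (ball x r) = unitVol n * r ^ n := by
  rw [Measure.real, volume_ball_eq x hr, ENNReal.toReal_ofReal]
  exact mul_nonneg (unitVol_pos n).le (by positivity)

lemma rpow_neg_mul_pow {s : ℝ} (hs : 0 < s) : s ^ (-(n : ℝ)) * s ^ n = 1 := by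
  rw [Real.rpow_neg hs.le, Real.rpow_natCast, inv_mul_cancel₀ (by positivity)]

lemma abs_mul_bump_le (hβ : 0 < β) (hβ1 : β ≤ 1) (h : MemCbeta β φ) (hs : 0 < s) (q : Rn n)
    (f : Rn n → ℝ) (u : Rn n) :
    |f u * bump φ s q u| ≤
      2 * s ^ (-(n : ℝ)) * (closedBall q s).indicator (fun v => |f v|) u := by
  by_cases hu : bump φ s q u = 0
  · rw [hu, mul_zero, abs_zero]
    exact mul_nonneg (by positivity) (indicator_nonneg (fun _ _ => abs_nonneg _) _)
  · rw [indicator_of_mem (mem_closedBall.2 (bump_support h hs hu)), abs_mul, mul_comm]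
    exact mul_le_mul_of_nonneg_right (bump_abs_le hβ hβ1 h hs q u) (abs_nonneg _)

lemma LocallyIntegrable.indicator_abs_integrable {f : Rn n → ℝ} (hf : LocallyIntegrable f)
    (q : Rn n) (s : ℝ) : Integrable ((closedBall q s).indicator fun v => |f v|) :=
  IntegrableOn.integrable_indicator (hf.integrableOn_isCompact (isCompact_closedBall q s)).abs
    measurableSet_closedBall

lemma mul_bump_integrable (hβ : 0 < β) (h : MemCbeta β φ) (hs : 0 < s) (q : Rn n)
    {f : Rn n → ℝ} (hf : LocallyIntegrable f) : Integrable fun u => f u * bump φ s q u := by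
  simpa [mul_comm] using hf.integrable_smul_left_of_hasCompactSupport
    (bump_continuous hβ h s q) (bump_hasCompactSupport h hs q)

lemma abs_convPhi_le (hβ : 0 < β) (hβ1 : β ≤ 1) (h : MemCbeta β φ) (hs : 0 < s) (q : Rn n)
    {f : Rn n → ℝ} (hf : LocallyIntegrable f) :
    |convPhi f φ s q| ≤ 2 * s ^ (-(n : ℝ)) * ∫ v in closedBall q s, |f v| := by
  rw [convPhi_eq, ← integral_indicator measurableSet_closedBall, ← integral_const_mul]
  refine abs_integral_le_integral_abs.trans (integral_mono (mul_bump_integrable hβ h hs q hf).abs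
    ((LocallyIntegrable.indicator_abs_integrable hf q s).const_mul _) fun u => ?_)
  exact abs_mul_bump_le hβ hβ1 h hs q f u

end bump

/-! ### Comparison of `A_β` at neighbouring points of the half space -/

lemma Abeta_bddAbove {β : ℝ} (hβ : 0 < β) (hβ1 : β ≤ 1) {f : Rn n → ℝ}
    (hf : LocallyIntegrable f) (y : Rn n) {t : ℝ} (ht : 0 < t) :
    BddAbove (range fun φ : {φ : Rn n → ℝ // MemCbeta β φ} => |convPhi f φ.1 t y|) :=
  ⟨_, by rintro _ ⟨φ, rfl⟩; exact abs_convPhi_le hβ hβ1 φ.2 ht y hf⟩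

lemma Abeta_nonneg (β : ℝ) (f : Rn n → ℝ) (y : Rn n) (t : ℝ) : 0 ≤ Abeta β f y t :=
  Real.iSup_nonneg fun _ => abs_nonneg _

lemma Abeta_le {β : ℝ} (hβ : 0 < β) (hβ1 : β ≤ 1) {f : Rn n → ℝ} (hf : LocallyIntegrable f)
    {y y' : Rn n} {t s K : ℝ} (ht : 0 < t) (hts : dist y y' + t ≤ s) (hsK : s ≤ K * t) :
    Abeta β f y t ≤ K ^ ((n : ℝ) + β) * Abeta β f y' s := by
  have : Nonempty {φ : Rn n → ℝ // MemCbeta β φ} := ⟨⟨0, MemCbeta.zero β⟩⟩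
  have hs : 0 < s := by linarith [dist_nonneg (x := y) (y := y')]
  have hst : 0 < s / t := div_pos hs ht
  refine ciSup_le fun ⟨φ, hφ⟩ => ?_
  set ψ : Rn n → ℝ := fun v => (s / t) ^ (-β) * φ ((s / t) • v + t⁻¹ • (y - y')) with hψ
  have hψm : MemCbeta β ψ := by
    refine ⟨fun v hv => ?_, ?_, ?_, fun v v' => ?_⟩
    · have h1 := hφ.1 _ (right_ne_zero_of_mul hv)
      have h2 : ‖(s / t) • v‖ ≤ 1 + ‖t⁻¹ • (y - y')‖ := by
        have := norm_sub_le ((s / t) • v + t⁻¹ • (y - y')) (t⁻¹ • (y - y'))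
        rw [add_sub_cancel_right] at this
        linarith
      rw [norm_smul, norm_smul, Real.norm_of_nonneg hst.le, norm_inv, Real.norm_of_nonneg ht.le,
        ← dist_eq_norm] at h2
      have h3 : s * ‖v‖ ≤ s * 1 := by
        have := mul_le_mul_of_nonneg_left h2 ht.le
        field_simp at this
        linarith
      exact le_of_mul_le_mul_left h3 hs
    · exact ((hφ.2.1.comp_add_right (t⁻¹ • (y - y'))).comp_smul hst.ne').const_mul _
    · rw [hψ, integral_const_mul,
        Measure.integral_comp_smul volume (fun v => φ (v + t⁻¹ • (y - y'))),
        integral_add_right_eq_self φ, hφ.2.2.1]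
      simp
    · rw [hψ]
      simp only
      rw [← mul_sub, abs_mul, abs_of_pos (Real.rpow_pos_of_pos hst _)]
      have := hφ.2.2.2 ((s / t) • v + t⁻¹ • (y - y')) ((s / t) • v' + t⁻¹ • (y - y'))
      rw [add_sub_add_right_eq_sub, ← smul_sub, norm_smul, Real.norm_of_nonneg hst.le,
        Real.mul_rpow hst.le (norm_nonneg _)] at this
      calc _ ≤ (s / t) ^ (-β) * ((s / t) ^ β * ‖v - v'‖ ^ β) :=
            mul_le_mul_of_nonneg_left this (Real.rpow_pos_of_pos hst _).le
        _ = ‖v - v'‖ ^ β := by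
            rw [← mul_assoc, ← Real.rpow_add hst]; simp
  have hconv : convPhi f φ t y = (s / t) ^ ((n : ℝ) + β) * convPhi f ψ s y' := by
    unfold convPhi
    rw [← integral_const_mul]
    congr 1
    ext u
    have e1 : (s / t) • s⁻¹ • (y' - u) + t⁻¹ • (y - y') = t⁻¹ • (y - u) := by
      rw [smul_smul, show s / t * s⁻¹ = t⁻¹ by field_simp, ← smul_add]
      congr 1
      abel
    have e2 : (s / t) ^ ((n : ℝ) + β) * (s ^ (-(n : ℝ)) * (s / t) ^ (-β)) = t ^ (-(n : ℝ)) := by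
      rw [Real.rpow_add hst, Real.rpow_neg hst.le β, Real.div_rpow hs.le ht.le,
        Real.rpow_neg hs.le, Real.rpow_neg ht.le]
      have := Real.rpow_pos_of_pos hst β
      have := Real.rpow_pos_of_pos hs n
      field_simp
    rw [hψ]
    simp only
    rw [e1, ← e2]
    ring
  have hK : (s / t) ^ ((n : ℝ) + β) ≤ K ^ ((n : ℝ) + β) :=
    Real.rpow_le_rpow hst.le ((div_le_iff₀ ht).2 hsK) (by positivity)
  calc |convPhi f φ t y| = (s / t) ^ ((n : ℝ) + β) * |convPhi f ψ s y'| := by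
        rw [hconv, abs_mul, abs_of_pos (Real.rpow_pos_of_pos hst _)]
    _ ≤ K ^ ((n : ℝ) + β) * Abeta β f y' s :=
        mul_le_mul hK (le_ciSup (Abeta_bddAbove hβ hβ1 hf y' hs) ⟨ψ, hψm⟩) (abs_nonneg _)
          ((Real.rpow_pos_of_pos hst _).le.trans hK)

/-! ### A discretization of the half space -/

/-- The scale `2^{1-k}`. -/
def scale (k : ℕ) : ℝ := 2 * (1 / 2) ^ k

lemma scale_pos (k : ℕ) : 0 < scale k := by unfold scale; positivity

lemma half_pow_eq_scale (k : ℕ) : (1 / 2 : ℝ) ^ k = scale k / 2 := by unfold scale; ring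

/-- Points of a fixed countable dense subset of `ℝⁿ`. -/
def cellCenter (i : ℕ × ℕ) : Rn n := TopologicalSpace.denseSeq (Rn n) i.1

/-- For each `k`, the sets `cell (p, k)` form a partition of `ℝⁿ` into pieces of size `2^{-k}`. -/
def cell (i : ℕ × ℕ) : Set (Rn n) :=
  disjointed (fun p => ball (TopologicalSpace.denseSeq (Rn n) p) ((1 / 2) ^ i.2)) i.1

lemma measurableSet_cell (i : ℕ × ℕ) : MeasurableSet (cell i : Set (Rn n)) :=
  MeasurableSet.disjointed (fun _ => measurableSet_ball) _

lemma cell_subset (i : ℕ × ℕ) : (cell i : Set (Rn n)) ⊆ ball (cellCenter i) ((1 / 2) ^ i.2) :=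
  disjointed_subset _ _

lemma dist_center_lt {i : ℕ × ℕ} {x : Rn n} (hx : x ∈ (cell i : Set (Rn n))) :
    dist x (cellCenter i) < scale i.2 / 2 := by
  rw [← half_pow_eq_scale]; exact cell_subset i hx

lemma exists_mem_cell (x : Rn n) (k : ℕ) : ∃ p, x ∈ (cell (p, k) : Set (Rn n)) := by
  have h : ⋃ p, (cell (p, k) : Set (Rn n)) = univ := by
    unfold cell
    simp only
    rw [iUnion_disjointed, eq_univ_iff_forall]
    intro y
    obtain ⟨p, hp⟩ := (TopologicalSpace.denseRange_denseSeq (Rn n)).exists_dist_lt y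
      (by positivity : (0 : ℝ) < (1 / 2) ^ k)
    exact mem_iUnion.2 ⟨p, hp⟩
  exact mem_iUnion.1 (h ▸ mem_univ x)

lemma cell_disjoint {i i' : ℕ × ℕ} (h2 : i.2 = i'.2) (h : i ≠ i') :
    Disjoint (cell i : Set (Rn n)) (cell i') := by
  have h1 : i.1 ≠ i'.1 := fun e => h (Prod.ext e h2)
  unfold cell
  rw [h2]
  exact disjoint_disjointed _ h1

lemma volume_cell_ne_top (i : ℕ × ℕ) : volume (cell i : Set (Rn n)) ≠ ⊤ :=
  ((measure_mono (cell_subset i)).trans_lt measure_ball_lt_top).ne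

lemma sum_cell_le (J : Finset (ℕ × ℕ)) (k : ℕ) (z : Rn n) {R : ℝ} (hR : scale k / 2 ≤ R) :
    ∑ i ∈ J with i.2 = k ∧ dist (cellCenter i) z ≤ R, volume.real (cell i : Set (Rn n)) ≤
      unitVol n * (2 * R) ^ n := by
  have hR0 : 0 < R := lt_of_lt_of_le (by have := scale_pos k; positivity) hR
  rw [← measureReal_biUnion_finset (h := fun i _ => volume_cell_ne_top i),
    ← volume_real_ball_eq z (by positivity : 0 < 2 * R)]
  · refine measureReal_mono (iUnion₂_subset fun i hi x hx => ?_) measure_ball_lt_top.ne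
    have h := (Finset.mem_filter.1 hi).2
    have h1 := dist_center_lt hx
    rw [h.1] at h1
    exact mem_ball.2 (by linarith [dist_triangle x (cellCenter i) z, h.2])
  · intro i hi i' hi' hne
    have h := (Finset.mem_filter.1 hi).2.1
    have h' := (Finset.mem_filter.1 hi').2.1
    exact cell_disjoint (h.trans h'.symm) hne
  · exact fun i _ => measurableSet_cell i

lemma sum_pow_le {ρ : ℝ} (h0 : 0 ≤ ρ) (h1 : ρ < 1) (K : Finset ℕ) (e : ℕ → ℕ)
    (he : Set.InjOn e K) : ∑ k ∈ K, ρ ^ e k ≤ (1 - ρ)⁻¹ := by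
  rw [← Finset.sum_image (f := fun m => ρ ^ m) he, ← tsum_geometric_of_lt_one h0 h1]
  exact (summable_geometric_of_lt_one h0 h1).sum_le_tsum _ fun _ _ => by positivity

lemma sum_min_div_max_le {β : ℝ} (hβ : 0 < β) {σ : ℝ} (hσ : 0 < σ) (K : Finset ℕ) :
    ∑ k ∈ K, (min (scale k) σ / max (scale k) σ) ^ β ≤ 2 * (1 - (1 / 2 : ℝ) ^ β)⁻¹ := by
  set ρ : ℝ := (1 / 2 : ℝ) ^ β
  have hρ0 : 0 ≤ ρ := by positivity
  have hρ1 : ρ < 1 := Real.rpow_lt_one (by norm_num) (by norm_num) hβ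
  have hex : ∃ k, scale k ≤ σ := by
    obtain ⟨k, hk⟩ := exists_pow_lt_of_lt_one (by positivity : 0 < σ / 2)
      (by norm_num : (1 / 2 : ℝ) < 1)
    exact ⟨k, by unfold scale; linarith⟩
  classical
  set m := Nat.find hex
  have hm : scale m ≤ σ := Nat.find_spec hex
  have hmin : ∀ k < m, σ < scale k := fun k hk => not_le.1 (Nat.find_min hex hk)
  have hadd : ∀ a b, scale (a + b) = scale a * (1 / 2) ^ b := fun a b => by
    unfold scale; rw [pow_add]; ring
  have hpow : ∀ e : ℕ, ((1 / 2 : ℝ) ^ e) ^ β = ρ ^ e := fun e => by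
    rw [← Real.rpow_natCast, ← Real.rpow_mul (by norm_num), mul_comm, Real.rpow_mul (by norm_num),
      Real.rpow_natCast]
  rw [← Finset.sum_filter_add_sum_filter_not K (fun k => m ≤ k), two_mul]
  refine add_le_add ?_ ?_
  · refine le_trans (Finset.sum_le_sum fun k hk => ?_)
      (sum_pow_le hρ0 hρ1 (K.filter fun k => m ≤ k) (fun k => k - m) ?_)
    · have hk := (Finset.mem_filter.1 hk).2
      have e : scale k = scale m * (1 / 2) ^ (k - m) := by rw [← hadd, Nat.add_sub_cancel' hk]
      have hle : scale k ≤ σ := by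
        rw [e]
        exact (mul_le_of_le_one_right (scale_pos m).le
          (pow_le_one₀ (by norm_num) (by norm_num))).trans hm
      rw [min_eq_left hle, max_eq_right hle, ← hpow]
      refine Real.rpow_le_rpow (div_nonneg (scale_pos k).le hσ.le) ?_ hβ.le
      rw [div_le_iff₀ hσ, e, mul_comm]
      gcongr
    · intro a ha b hb hab
      have ha := (Finset.mem_filter.1 ha).2
      have hb := (Finset.mem_filter.1 hb).2
      simp only at hab
      omega
  · refine le_trans (Finset.sum_le_sum fun k hk => ?_)
      (sum_pow_le hρ0 hρ1 (K.filter fun k => ¬ m ≤ k) (fun k => m - 1 - k) ?_)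
    · have hk := not_le.1 (Finset.mem_filter.1 hk).2
      have e : scale (m - 1) = scale k * (1 / 2) ^ (m - 1 - k) := by
        rw [← hadd, Nat.add_sub_cancel' (by omega)]
      have hle : σ ≤ scale k := (hmin k hk).le
      rw [min_eq_right hle, max_eq_left hle, ← hpow]
      refine Real.rpow_le_rpow (div_nonneg hσ.le (scale_pos k).le) ?_ hβ.le
      rw [div_le_iff₀ (scale_pos k), mul_comm, ← e]
      exact (hmin (m - 1) (by omega)).le
    · intro a ha b hb hab
      have ha := (Finset.mem_filter.1 ha).2
      have hb := (Finset.mem_filter.1 hb).2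
      simp only at hab
      omega

/-- The almost orthogonality factor of two scales. -/
def scaleKer (n : ℕ) (β a b : ℝ) : ℝ := max a b ^ (-(n : ℝ)) * (min a b / max a b) ^ β

lemma scaleKer_nonneg {β a b : ℝ} (ha : 0 < a) (hb : 0 < b) : 0 ≤ scaleKer n β a b := by
  have := lt_min ha hb
  have : 0 < max a b := lt_max_of_lt_left ha
  unfold scaleKer
  positivity

lemma scaleKer_comm (β a b : ℝ) : scaleKer n β a b = scaleKer n β b a := by
  unfold scaleKer; rw [max_comm, min_comm]

/-- The constant of the Schur test. -/
def schurConst (n : ℕ) (β : ℝ) : ℝ := unitVol n * 4 ^ n * (2 * (1 - (1 / 2 : ℝ) ^ β)⁻¹)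

lemma schurConst_pos (n : ℕ) {β : ℝ} (hβ : 0 < β) : 0 < schurConst n β := by
  have : (1 / 2 : ℝ) ^ β < 1 := Real.rpow_lt_one (by norm_num) (by norm_num) hβ
  have := unitVol_pos n
  have : 0 < (1 - (1 / 2 : ℝ) ^ β)⁻¹ := inv_pos.2 (by linarith)
  unfold schurConst
  positivity

lemma sum_scaleKer_le {β : ℝ} (hβ : 0 < β) {σ : ℝ} (hσ : 0 < σ) (z : Rn n)
    (J : Finset (ℕ × ℕ)) :
    ∑ i ∈ J with dist (cellCenter i) z ≤ 2 * max (scale i.2) σ,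
      volume.real (cell i : Set (Rn n)) * scaleKer n β (scale i.2) σ ≤ schurConst n β := by
  classical
  rw [← Finset.sum_fiberwise_of_maps_to (t := J.image Prod.snd) (g := Prod.snd)
    (fun i hi => Finset.mem_image_of_mem _ (Finset.mem_filter.1 hi).1)]
  unfold schurConst
  refine le_trans ?_ (mul_le_mul_of_nonneg_left (sum_min_div_max_le hβ hσ (J.image Prod.snd))
    (by have := unitVol_pos n; positivity))
  rw [Finset.mul_sum]
  refine Finset.sum_le_sum fun k _ => ?_
  set M := max (scale k) σ with hM
  have hM0 : 0 < M := lt_max_of_lt_right hσ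
  rw [Finset.filter_filter]
  calc _ = ∑ i ∈ J with i.2 = k ∧ dist (cellCenter i) z ≤ 2 * M,
        volume.real (cell i : Set (Rn n)) * scaleKer n β (scale k) σ := by
        refine Finset.sum_congr (Finset.filter_congr fun i _ => ?_) fun i hi => ?_
        · constructor
          · rintro ⟨h, rfl⟩; exact ⟨rfl, h⟩
          · rintro ⟨rfl, h⟩; exact ⟨h, rfl⟩
        · rw [(Finset.mem_filter.1 hi).2.1]
    _ ≤ unitVol n * (2 * (2 * M)) ^ n * scaleKer n β (scale k) σ := by
        rw [← Finset.sum_mul]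
        refine mul_le_mul_of_nonneg_right (sum_cell_le J k z ?_)
          (scaleKer_nonneg (scale_pos k) hσ)
        linarith [le_max_left (scale k) σ, scale_pos k]
    _ = _ := by
        have := rpow_neg_mul_pow (n := n) hM0
        unfold scaleKer
        rw [← hM, show 2 * (2 * M) = 4 * M by ring, mul_pow]
        linear_combination (unitVol n * 4 ^ n * (min (scale k) σ / M) ^ β) * this

/-! ### Almost orthogonality of the dilated test functions -/

lemma integral_abs_bump_le {β : ℝ} (hβ : 0 < β) (hβ1 : β ≤ 1) {φ : Rn n → ℝ}
    (h : MemCbeta β φ) {s : ℝ} (hs : 0 < s) (q : Rn n) :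
    ∫ u, |bump φ s q u| ≤ 2 * unitVol n := by
  have hv : volume.real (closedBall q s) = unitVol n * s ^ n := by
    rw [Measure.addHaar_real_closedBall volume q hs.le, finrank_euclideanSpace_fin, mul_comm]
    rfl
  calc ∫ u, |bump φ s q u|
      ≤ ∫ u, (closedBall q s).indicator (fun _ => 2 * s ^ (-(n : ℝ))) u := by
        refine integral_mono (bump_integrable hβ h hs q).abs
          ((integrable_indicator_iff measurableSet_closedBall).2
            (integrableOn_const measure_closedBall_lt_top.ne)) fun u => ?_
        have := abs_mul_bump_le hβ hβ1 h hs q (fun _ => 1) u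
        simp only [one_mul, abs_one] at this
        refine this.trans_eq ?_
        by_cases hu : u ∈ closedBall q s <;> simp [indicator, hu]
    _ = 2 * unitVol n := by
        rw [integral_indicator measurableSet_closedBall, setIntegral_const, hv, smul_eq_mul]
        linear_combination (2 * unitVol n) * rpow_neg_mul_pow (n := n) hs

lemma bump_mul_integrable {β : ℝ} (hβ : 0 < β) {φ φ' : Rn n → ℝ}
    (h : MemCbeta β φ) (h' : MemCbeta β φ') {s : ℝ} (hs : 0 < s) (s' : ℝ) (q q' : Rn n) :
    Integrable fun u => bump φ s q u * bump φ' s' q' u :=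
  ((bump_continuous hβ h s q).mul (bump_continuous hβ h' s' q')).integrable_of_hasCompactSupport
    (bump_hasCompactSupport h hs q).mul_right

lemma abs_integral_bump_mul_le_of_le {β : ℝ} (hβ : 0 < β) (hβ1 : β ≤ 1) {φ φ' : Rn n → ℝ}
    (h : MemCbeta β φ) (h' : MemCbeta β φ') {s s' : ℝ} (hs : 0 < s) (hs' : 0 < s')
    (hss : s' ≤ s) (q q' : Rn n) :
    |∫ u, bump φ s q u * bump φ' s' q' u| ≤ 2 * unitVol n * scaleKer n β s s' := by
  have e : ∫ u, bump φ s q u * bump φ' s' q' u =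
      ∫ u, (bump φ s q u - bump φ s q q') * bump φ' s' q' u := by
    simp_rw [sub_mul]
    rw [integral_sub (bump_mul_integrable hβ h h' hs s' q q')
      ((bump_integrable hβ h' hs' q').const_mul _), integral_const_mul, integral_bump h']
    simp
  have hk : scaleKer n β s s' = s ^ (-(n : ℝ)) * (s' / s) ^ β := by
    unfold scaleKer; rw [max_eq_left hss, min_eq_right hss]
  have hk0 := scaleKer_nonneg (n := n) (β := β) hs hs'
  rw [e]
  calc |∫ u, (bump φ s q u - bump φ s q q') * bump φ' s' q' u|
      ≤ ∫ u, scaleKer n β s s' * |bump φ' s' q' u| := by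
        refine abs_integral_le_integral_abs.trans (integral_mono_of_nonneg
          (Filter.Eventually.of_forall fun _ => abs_nonneg _)
          ((bump_integrable hβ h' hs' q').abs.const_mul _)
          (Filter.Eventually.of_forall fun u => ?_))
        simp only [abs_mul]
        by_cases hu : bump φ' s' q' u = 0
        · simp [hu]
        refine mul_le_mul_of_nonneg_right ((bump_abs_sub_le h hs q u q').trans ?_) (abs_nonneg _)
        rw [hk]
        have := bump_support h' hs' hu
        gcongr
    _ ≤ scaleKer n β s s' * (2 * unitVol n) := by
        rw [integral_const_mul]
        exact mul_le_mul_of_nonneg_left (integral_abs_bump_le hβ hβ1 h' hs' q') hk0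
    _ = _ := mul_comm _ _

lemma abs_integral_bump_mul_le {β : ℝ} (hβ : 0 < β) (hβ1 : β ≤ 1) {φ φ' : Rn n → ℝ}
    (h : MemCbeta β φ) (h' : MemCbeta β φ') {s s' : ℝ} (hs : 0 < s) (hs' : 0 < s')
    (q q' : Rn n) :
    |∫ u, bump φ s q u * bump φ' s' q' u| ≤
      if dist q' q ≤ 2 * max s' s then 2 * unitVol n * scaleKer n β s' s else 0 := by
  split_ifs with hd
  · rcases le_total s' s with hss | hss
    · rw [scaleKer_comm]
      exact abs_integral_bump_mul_le_of_le hβ hβ1 h h' hs hs' hss q q'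
    · simp_rw [mul_comm (bump φ s q _)]
      exact abs_integral_bump_mul_le_of_le hβ hβ1 h' h hs' hs hss q' q
  · have : ∀ u, bump φ s q u * bump φ' s' q' u = 0 := by
      intro u
      by_contra hne
      have h1 := bump_support h hs (left_ne_zero_of_mul hne)
      have h2 := bump_support h' hs' (right_ne_zero_of_mul hne)
      have := dist_triangle_left q' q u
      exact hd (by linarith [le_max_left s' s, le_max_right s' s])
    simp [this]

/-- A finite superposition of the dilated test functions. -/
def superpos (φ : ℕ × ℕ → Rn n → ℝ) (c : ℕ × ℕ → ℝ) (J : Finset (ℕ × ℕ)) (u : Rn n) : ℝ :=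
  ∑ i ∈ J, volume.real (cell i : Set (Rn n)) * c i * bump (φ i) (scale i.2) (cellCenter i) u

lemma superpos_continuous {β : ℝ} (hβ : 0 < β) {φ : ℕ × ℕ → Rn n → ℝ}
    (hφ : ∀ i, MemCbeta β (φ i)) (c : ℕ × ℕ → ℝ) (J : Finset (ℕ × ℕ)) :
    Continuous (superpos φ c J) :=
  continuous_finsetSum _ fun i _ => continuous_const.mul (bump_continuous hβ (hφ i) _ _)

lemma superpos_sq_eq (φ : ℕ × ℕ → Rn n → ℝ) (c : ℕ × ℕ → ℝ) (J : Finset (ℕ × ℕ)) (u : Rn n) :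
    superpos φ c J u ^ 2 = ∑ i ∈ J, ∑ j ∈ J,
      volume.real (cell i : Set (Rn n)) * c i * (volume.real (cell j : Set (Rn n)) * c j) *
        (bump (φ i) (scale i.2) (cellCenter i) u * bump (φ j) (scale j.2) (cellCenter j) u) := by
  rw [sq, superpos, Finset.sum_mul_sum]
  exact Finset.sum_congr rfl fun i _ => Finset.sum_congr rfl fun j _ => by ring

lemma superpos_sq_integrable {β : ℝ} (hβ : 0 < β) {φ : ℕ × ℕ → Rn n → ℝ}
    (hφ : ∀ i, MemCbeta β (φ i)) (c : ℕ × ℕ → ℝ) (J : Finset (ℕ × ℕ)) :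
    Integrable fun u => superpos φ c J u ^ 2 := by
  simp_rw [superpos_sq_eq]
  exact integrable_finsetSum _ fun i _ => integrable_finsetSum _ fun j _ =>
    (bump_mul_integrable hβ (hφ i) (hφ j) (scale_pos _) _ _ _).const_mul _

lemma integral_superpos_sq_le {β : ℝ} (hβ : 0 < β) (hβ1 : β ≤ 1) {φ : ℕ × ℕ → Rn n → ℝ}
    (hφ : ∀ i, MemCbeta β (φ i)) (c : ℕ × ℕ → ℝ) (J : Finset (ℕ × ℕ)) :
    ∫ u, superpos φ c J u ^ 2 ≤ 2 * unitVol n * schurConst n β *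
      ∑ i ∈ J, volume.real (cell i : Set (Rn n)) * c i ^ 2 := by
  set m : ℕ × ℕ → ℝ := fun i => volume.real (cell i : Set (Rn n)) with hm
  have hm0 : ∀ i, 0 ≤ m i := fun i => measureReal_nonneg
  set G : ℕ × ℕ → ℕ × ℕ → ℝ := fun i j =>
    ∫ u, bump (φ i) (scale i.2) (cellCenter i) u * bump (φ j) (scale j.2) (cellCenter j) u with hG
  have hGs : ∀ i j, G i j = G j i := fun i j => by simp_rw [hG, mul_comm]
  have e : ∫ u, superpos φ c J u ^ 2 = ∑ i ∈ J, ∑ j ∈ J, m i * c i * (m j * c j) * G i j := by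
    simp_rw [superpos_sq_eq]
    have hint : ∀ i j, Integrable fun u =>
        volume.real (cell i : Set (Rn n)) * c i * (volume.real (cell j : Set (Rn n)) * c j) *
        (bump (φ i) (scale i.2) (cellCenter i) u * bump (φ j) (scale j.2) (cellCenter j) u) :=
      fun i j => (bump_mul_integrable hβ (hφ i) (hφ j) (scale_pos _) _ _ _).const_mul _
    rw [integral_finsetSum _ fun i _ => integrable_finsetSum _ fun j _ => hint i j]
    refine Finset.sum_congr rfl fun i _ => ?_
    rw [integral_finsetSum _ fun j _ => hint i j]
    exact Finset.sum_congr rfl fun j _ => integral_const_mul _ _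
  have hrow : ∀ i, ∑ j ∈ J, m j * |G i j| ≤ 2 * unitVol n * schurConst n β := fun i => by
    refine le_trans ?_ (mul_le_mul_of_nonneg_left
      (sum_scaleKer_le hβ (scale_pos i.2) (cellCenter i : Rn n) J)
      (by have := unitVol_pos n; positivity))
    rw [Finset.sum_filter, Finset.mul_sum]
    refine Finset.sum_le_sum fun j _ => ?_
    refine (mul_le_mul_of_nonneg_left (abs_integral_bump_mul_le hβ hβ1 (hφ i) (hφ j)
      (scale_pos _) (scale_pos _) _ _) (hm0 j)).trans_eq ?_
    split_ifs <;> ring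
  obtain ⟨P, hP⟩ : ∃ P : ℕ × ℕ → ℕ × ℕ → ℝ, ∀ i j, P i j = m i * c i ^ 2 * (m j * |G i j|) :=
    ⟨_, fun _ _ => rfl⟩
  have h1 : ∀ i j, m i * c i * (m j * c j) * G i j ≤
      2⁻¹ * P i j + 2⁻¹ * P j i := by
    intro i j
    rw [hP, hP, hGs j i]
    have hcc : c i * c j * G i j ≤ 2⁻¹ * (c i ^ 2 + c j ^ 2) * |G i j| := by
      refine (le_abs_self _).trans ?_
      rw [abs_mul]
      refine mul_le_mul_of_nonneg_right ?_ (abs_nonneg _)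
      rw [abs_le]
      constructor <;> nlinarith [sq_nonneg (c i + c j), sq_nonneg (c i - c j)]
    have := mul_le_mul_of_nonneg_left hcc (mul_nonneg (hm0 i) (hm0 j))
    linarith
  have h2 : ∑ i ∈ J, ∑ j ∈ J, P i j ≤
      2 * unitVol n * schurConst n β * ∑ i ∈ J, m i * c i ^ 2 := by
    rw [Finset.mul_sum]
    refine Finset.sum_le_sum fun i _ => ?_
    simp_rw [hP]
    rw [← Finset.mul_sum, mul_comm (2 * unitVol n * schurConst n β)]
    exact mul_le_mul_of_nonneg_left (hrow i) (mul_nonneg (hm0 i) (sq_nonneg _))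
  rw [e]
  refine (Finset.sum_le_sum fun i _ => Finset.sum_le_sum fun j _ => h1 i j).trans ?_
  simp_rw [Finset.sum_add_distrib, ← Finset.mul_sum]
  rw [Finset.sum_comm (f := fun i j => P j i)]
  linarith

lemma abs_superpos_sub_le {β : ℝ} (hβ : 0 < β) {φ : ℕ × ℕ → Rn n → ℝ}
    (hφ : ∀ i, MemCbeta β (φ i)) {c : ℕ × ℕ → ℝ} {J : Finset (ℕ × ℕ)} {F : Set (Rn n)}
    (hJ : ∀ i ∈ J, ∃ x ∈ F, dist (cellCenter i) x < scale i.2 / 2) {A : ℝ}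
    (hc : ∀ i ∈ J, |c i| ≤ A) (hA : 0 ≤ A) {v v' : Rn n} (hv : 0 < infDist v F)
    (hvv' : dist v v' < infDist v F / 4) :
    |superpos φ c J v - superpos φ c J v'| ≤ A * schurConst n β := by
  set σ : ℝ := infDist v F / 2 with hσ
  have hσ0 : 0 < σ := by positivity
  refine le_trans ?_ (mul_le_mul_of_nonneg_left (sum_scaleKer_le hβ hσ0 v J) hA)
  rw [superpos, superpos, ← Finset.sum_sub_distrib, Finset.sum_filter, Finset.mul_sum]
  refine (Finset.abs_sum_le_sum_abs _ _).trans (Finset.sum_le_sum fun i hi => ?_)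
  have hs := scale_pos i.2
  have hm0 : 0 ≤ volume.real (cell i : Set (Rn n)) := measureReal_nonneg
  by_cases h0 : bump (φ i) (scale i.2) (cellCenter i) v = 0 ∧
      bump (φ i) (scale i.2) (cellCenter i) v' = 0
  · rw [h0.1, h0.2]
    have := scaleKer_nonneg (n := n) (β := β) hs hσ0
    simp only [mul_zero, sub_zero, abs_zero]
    split_ifs <;> positivity
  have hd : dist v (cellCenter i) ≤ scale i.2 + infDist v F / 4 := by
    rw [not_and_or] at h0
    rcases h0 with h0 | h0
    · linarith [bump_support (hφ i) hs h0]
    · linarith [bump_support (hφ i) hs h0, dist_triangle v v' (cellCenter i)]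
  have hd2 : infDist v F ≤ dist v (cellCenter i) + scale i.2 / 2 := by
    obtain ⟨x, hx, hx'⟩ := hJ i hi
    linarith [infDist_le_dist_of_mem (x := v) hx, dist_triangle v (cellCenter i) x]
  have hσs : σ ≤ scale i.2 := by rw [hσ]; linarith
  rw [if_pos (by rw [dist_comm, max_eq_left hσs]; linarith), ← mul_sub, abs_mul, abs_mul,
    abs_of_nonneg hm0, mul_left_comm, mul_assoc]
  refine mul_le_mul_of_nonneg_left ?_ hm0
  refine mul_le_mul (hc i hi) ((bump_abs_sub_le (hφ i) hs _ v v').trans ?_) (abs_nonneg _) hA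
  unfold scaleKer
  rw [max_eq_left hσs, min_eq_right hσs]
  have : dist v v' ≤ σ := by rw [hσ]; linarith
  gcongr

/-! ### Estimates on the set where the maximal function is bounded -/

lemma ae_norm_le_of_infDist_eq_zero {f : Rn n → ℝ} (hf : Integrable f) {F : Set (Rn n)}
    (hF0 : F.Nonempty) {N : ℝ}
    (hF : ∀ x ∈ F, ∀ r > 0, ∫ u in ball x r, |f u| ≤ N * r ^ n) :
    ∀ᵐ v : Rn n, infDist v F = 0 → |f v| ≤ N * 4 ^ n / unitVol n := by
  filter_upwards [(Besicovitch.vitaliFamily (volume : Measure (Rn n))).ae_tendsto_average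
    hf.abs.locallyIntegrable] with v hv h0
  have ht := hv.comp (Besicovitch.tendsto_filterAt volume v)
  refine le_of_tendsto ht ?_
  filter_upwards [self_mem_nhdsWithin] with r (hr : 0 < r)
  obtain ⟨x, hx, hxv⟩ := (infDist_lt_iff hF0).1 (h0.trans_lt hr)
  have hV := unitVol_pos n
  have hvol : volume.real (closedBall v r) = unitVol n * r ^ n := by
    rw [Measure.addHaar_real_closedBall volume v hr.le, finrank_euclideanSpace_fin, mul_comm]
    rfl
  have hle : ∫ u in closedBall v r, |f u| ≤ N * (4 * r) ^ n := by
    refine le_trans ?_ (hF x hx (4 * r) (by positivity))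
    refine setIntegral_mono_set hf.abs.integrableOn
      (Filter.Eventually.of_forall fun _ => abs_nonneg _)
      (LE.le.eventuallyLE fun u hu => ?_)
    have : dist u v ≤ r := hu
    exact mem_ball.2 (by linarith [dist_triangle u v x])
  simp only [Function.comp_apply, setAverage_eq, hvol, smul_eq_mul]
  rw [inv_mul_le_iff₀ (by positivity)]
  refine hle.trans_eq ?_
  rw [mul_pow]
  field_simp

/-- The kernel averaging over a ball of radius comparable to the distance to `F`. -/
def avgKer (F : Set (Rn n)) : Rn n × Rn n → ENNReal :=
  {p : Rn n × Rn n | dist p.2 p.1 < infDist p.1 F / 4}.indicator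
    fun p => (ENNReal.ofReal (unitVol n * (infDist p.1 F / 4) ^ n))⁻¹

lemma measurable_avgKer (F : Set (Rn n)) : Measurable (avgKer F) := by
  have hd : Measurable fun p : Rn n × Rn n => infDist p.1 F :=
    ((continuous_infDist_pt F).comp continuous_fst).measurable
  exact Measurable.indicator (by fun_prop)
    (measurableSet_lt (measurable_snd.dist measurable_fst) (hd.div_const 4))

lemma lintegral_avgKer {F : Set (Rn n)} {v : Rn n} (hv : 0 < infDist v F) :
    ∫⁻ u, avgKer F (v, u) = 1 := by
  have hr : 0 < infDist v F / 4 := by positivity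
  have e : (fun u => avgKer F (v, u)) = (ball v (infDist v F / 4)).indicator
      fun _ => (ENNReal.ofReal (unitVol n * (infDist v F / 4) ^ n))⁻¹ := by
    ext u
    by_cases hu : dist u v < infDist v F / 4 <;> simp [avgKer, indicator, hu]
  rw [e, lintegral_indicator measurableSet_ball, setLIntegral_const, volume_ball_eq v hr]
  have : 0 < unitVol n * (infDist v F / 4) ^ n := mul_pos (unitVol_pos n) (by positivity)
  exact ENNReal.inv_mul_cancel (by simpa using this) ENNReal.ofReal_ne_top

lemma lintegral_mul_avgKer_le {f : Rn n → ℝ} (hf : Integrable f) {F : Set (Rn n)}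
    (hF0 : F.Nonempty) {N : ℝ}
    (hF : ∀ x ∈ F, ∀ r > 0, ∫ u in ball x r, |f u| ≤ N * r ^ n) (u : Rn n) :
    ∫⁻ v, ‖f v‖ₑ * avgKer F (v, u) ≤ ENNReal.ofReal (N * 15 ^ n / unitVol n) := by
  have hV := unitVol_pos n
  set δ := infDist u F with hδ
  have hcomp : ∀ v, dist u v < infDist v F / 4 →
      4 / 5 * δ ≤ infDist v F ∧ infDist v F ≤ 4 / 3 * δ := by
    intro v hv
    have h1 : δ ≤ infDist v F + dist u v := infDist_le_infDist_add_dist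
    have h2 : infDist v F ≤ δ + dist v u := infDist_le_infDist_add_dist
    rw [dist_comm] at h2
    constructor <;> linarith
  rcases (infDist_nonneg (x := u) (s := F)).eq_or_lt with h0 | h0
  · have : ∀ v, ‖f v‖ₑ * avgKer F (v, u) = 0 := by
      intro v
      have : ¬ dist u v < infDist v F / 4 := fun hv => by
        have := (hcomp v hv).2
        rw [hδ, ← h0] at this
        linarith [dist_nonneg (x := u) (y := v)]
      simp [avgKer, indicator, this]
    simp [this]
  · have hδ0 : 0 < δ := h0
    obtain ⟨x, hx, hxu⟩ := (infDist_lt_iff (r := 2 * δ) hF0).1 (by linarith)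
    have hpt : ∀ v, ‖f v‖ₑ * avgKer F (v, u) ≤ (ball x (3 * δ)).indicator (fun v => ‖f v‖ₑ) v *
        (ENNReal.ofReal (unitVol n * (δ / 5) ^ n))⁻¹ := by
      intro v
      by_cases hv : dist u v < infDist v F / 4
      · have hc := hcomp v hv
        have hvx : v ∈ ball x (3 * δ) := by
          have := dist_triangle v u x
          rw [dist_comm v u] at this
          exact mem_ball.2 (by linarith)
        rw [indicator_of_mem hvx]
        simp only [avgKer, indicator, mem_ofPred_eq, hv, if_true]
        have h5 : δ / 5 ≤ infDist v F / 4 := by linarith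
        exact mul_le_mul_right (ENNReal.inv_le_inv.2 (ENNReal.ofReal_le_ofReal
          (mul_le_mul_of_nonneg_left (pow_le_pow_left₀ (by positivity) h5 n) hV.le))) _
      · simp [avgKer, indicator, hv]
    refine (lintegral_mono hpt).trans ?_
    have hc0 : 0 < unitVol n * (δ / 5) ^ n := mul_pos (unitVol_pos n) (by positivity)
    rw [lintegral_mul_const' _ _ (by simpa using hc0), lintegral_indicator measurableSet_ball,
      ← ofReal_integral_norm_eq_lintegral_enorm hf.integrableOn, ← ENNReal.ofReal_inv_of_pos hc0,
      ← ENNReal.ofReal_mul (by positivity)]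
    refine ENNReal.ofReal_le_ofReal ?_
    refine (mul_le_mul_of_nonneg_right (hF x hx _ (by positivity)) (by positivity)).trans_eq ?_
    rw [mul_pow, div_pow, show (15 : ℝ) = 3 * 5 by norm_num, mul_pow]
    field_simp

lemma lintegral_mul_le {f : Rn n → ℝ} (hf : Integrable f) {F : Set (Rn n)}
    (hF0 : F.Nonempty) {N : ℝ} (hN : 0 ≤ N)
    (hF : ∀ x ∈ F, ∀ r > 0, ∫ u in ball x r, |f u| ≤ N * r ^ n)
    {h : Rn n → ℝ} (hh : Continuous h) {A ε : ℝ} (hA : 0 ≤ A) (hε : 0 < ε)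
    (hosc : ∀ v v', 0 < infDist v F → dist v v' < infDist v F / 4 → |h v - h v'| ≤ A) :
    ∫⁻ v, ‖f v‖ₑ * ‖h v‖ₑ ≤ ENNReal.ofReal (A + 1 / (4 * ε)) * (∫⁻ v, ‖f v‖ₑ) +
      ENNReal.ofReal (2 * ε * (N * 15 ^ n / unitVol n)) * ∫⁻ v, ENNReal.ofReal (h v ^ 2) := by
  have hV := unitVol_pos n
  set N' := N * 15 ^ n / unitVol n with hN'
  have hN'0 : 0 ≤ N' := by positivity
  set K := A + 1 / (4 * ε) with hK
  have hK0 : 0 ≤ K := by positivity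
  have hamgm : ∀ a : ℝ, |a| ≤ 1 / (4 * ε) + ε * a ^ 2 := by
    intro a
    have : 0 ≤ (2 * ε * |a| - 1) ^ 2 / (4 * ε) := by positivity
    have e : (2 * ε * |a| - 1) ^ 2 / (4 * ε) = ε * |a| ^ 2 - |a| + 1 / (4 * ε) := by
      field_simp; ring
    rw [e, sq_abs] at this
    linarith
  have hmS : Measurable fun v => ENNReal.ofReal (h v ^ 2) :=
    (hh.measurable.pow_const 2).ennreal_ofReal
  have hpos : ∀ v, 0 < infDist v F → ‖h v‖ₑ ≤ ENNReal.ofReal K +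
      ENNReal.ofReal ε * ∫⁻ u, avgKer F (v, u) * ENNReal.ofReal (h u ^ 2) := by
    intro v hv
    have hmk : Measurable fun u => avgKer F (v, u) :=
      (measurable_avgKer F).comp measurable_prodMk_left
    calc ‖h v‖ₑ = ∫⁻ u, avgKer F (v, u) * ‖h v‖ₑ := by
          rw [lintegral_mul_const _ hmk, lintegral_avgKer hv, one_mul]
      _ ≤ ∫⁻ u, (avgKer F (v, u) * ENNReal.ofReal K +
            ENNReal.ofReal ε * (avgKer F (v, u) * ENNReal.ofReal (h u ^ 2))) := by
          refine lintegral_mono fun u => ?_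
          by_cases hu : dist u v < infDist v F / 4
          · rw [mul_left_comm, ← mul_add]
            gcongr
            rw [← ENNReal.ofReal_mul hε.le, ← ENNReal.ofReal_add hK0 (by positivity),
              ← ofReal_norm]
            refine ENNReal.ofReal_le_ofReal ?_
            rw [Real.norm_eq_abs]
            have h1 := hosc v u hv (by rwa [dist_comm])
            have h2 := hamgm (h u)
            have h3 := abs_sub_abs_le_abs_sub (h v) (h u)
            rw [hK]
            linarith
          · simp [avgKer, indicator, hu]
      _ = _ := by
          rw [lintegral_add_left (hmk.mul_const _), lintegral_mul_const _ hmk, lintegral_avgKer hv,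
            one_mul, lintegral_const_mul' _ _ ENNReal.ofReal_ne_top]
  have hae : ∀ᵐ v, ‖f v‖ₑ * ‖h v‖ₑ ≤ (ENNReal.ofReal K * ‖f v‖ₑ + ENNReal.ofReal (ε * N') *
      ENNReal.ofReal (h v ^ 2)) +
      ENNReal.ofReal ε * ∫⁻ u, ‖f v‖ₑ * (avgKer F (v, u) * ENNReal.ofReal (h u ^ 2)) := by
    filter_upwards [ae_norm_le_of_infDist_eq_zero hf hF0 hF] with v hv
    rcases (infDist_nonneg (x := v) (s := F)).eq_or_lt with h0 | h0
    · refine le_add_right ?_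
      have hfv : |f v| ≤ N' := by
        refine (hv h0.symm).trans ?_
        rw [hN']
        gcongr
        norm_num
      rw [← ofReal_norm, ← ofReal_norm, ← ENNReal.ofReal_mul (norm_nonneg _),
        ← ENNReal.ofReal_mul hK0, ← ENNReal.ofReal_mul (by positivity),
        ← ENNReal.ofReal_add (by positivity) (by positivity)]
      refine ENNReal.ofReal_le_ofReal ?_
      rw [Real.norm_eq_abs, Real.norm_eq_abs]
      have h1 := mul_le_mul_of_nonneg_left (hamgm (h v)) (abs_nonneg (f v))
      have h2 : |f v| * (ε * h v ^ 2) ≤ N' * (ε * h v ^ 2) := by gcongr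
      have h3 : 0 ≤ A * |f v| := by positivity
      rw [hK]
      linarith
    · rw [lintegral_const_mul' _ _ enorm_ne_top]
      calc _ ≤ ‖f v‖ₑ * _ := mul_le_mul_right (hpos v h0) _
        _ = ENNReal.ofReal K * ‖f v‖ₑ + ENNReal.ofReal ε *
            (‖f v‖ₑ * ∫⁻ u, avgKer F (v, u) * ENNReal.ofReal (h u ^ 2)) := by ring
        _ ≤ _ := by gcongr; exact le_self_add
  have hfm : AEMeasurable (fun v => ‖f v‖ₑ) := hf.aestronglyMeasurable.enorm
  have hswap : ∫⁻ v, ∫⁻ u, ‖f v‖ₑ * (avgKer F (v, u) * ENNReal.ofReal (h u ^ 2)) ≤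
      ENNReal.ofReal N' * ∫⁻ u, ENNReal.ofReal (h u ^ 2) := by
    rw [lintegral_lintegral_swap, ← lintegral_const_mul _ hmS]
    · refine lintegral_mono fun u => ?_
      simp_rw [← mul_assoc]
      rw [lintegral_mul_const' _ _ ENNReal.ofReal_ne_top]
      gcongr
      exact lintegral_mul_avgKer_le hf hF0 hF u
    · exact hfm.comp_fst.mul
        ((measurable_avgKer F).mul (hmS.comp measurable_snd)).aemeasurable
  have h12 : AEMeasurable (fun v => ENNReal.ofReal K * ‖f v‖ₑ + ENNReal.ofReal (ε * N') *
      ENNReal.ofReal (h v ^ 2)) := (hfm.const_mul _).add (hmS.const_mul _).aemeasurable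
  refine (lintegral_mono_ae hae).trans ?_
  rw [lintegral_add_left' h12,
    lintegral_add_left' (hfm.const_mul _), lintegral_const_mul'' _ hfm, lintegral_const_mul _ hmS,
    lintegral_const_mul' _ _ ENNReal.ofReal_ne_top, add_assoc]
  gcongr
  calc _ ≤ ENNReal.ofReal (ε * N') * (∫⁻ v, ENNReal.ofReal (h v ^ 2)) +
        ENNReal.ofReal ε * (ENNReal.ofReal N' * ∫⁻ u, ENNReal.ofReal (h u ^ 2)) := by gcongr
    _ = _ := by
        rw [← mul_assoc, ← ENNReal.ofReal_mul hε.le, ← add_mul,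
          ← ENNReal.ofReal_add (by positivity) (by positivity)]
        congr 2
        ring

lemma exists_sum_convPhi_sq_le {β : ℝ} (hβ : 0 < β) (hβ1 : β ≤ 1) {f : Rn n → ℝ}
    (hf : Integrable f) {F : Set (Rn n)} (hF0 : F.Nonempty) {N : ℝ} (hN : 0 ≤ N)
    (hF : ∀ x ∈ F, ∀ r > 0, ∫ u in ball x r, |f u| ≤ N * r ^ n) :
    ∃ C : ℝ, ∀ φ : ℕ × ℕ → Rn n → ℝ, (∀ i, MemCbeta β (φ i)) → ∀ J : Finset (ℕ × ℕ),
      (∀ i ∈ J, ∃ x ∈ F, dist (cellCenter i) x < scale i.2 / 2) →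
      ∑ i ∈ J, volume.real (cell i : Set (Rn n)) *
        convPhi f (φ i) (scale i.2) (cellCenter i) ^ 2 ≤ C := by
  have hV := unitVol_pos n
  have hS := schurConst_pos n hβ
  set A := 2 * N * 2 ^ n with hA
  have hA0 : 0 ≤ A := by positivity
  set D := 2 * (N * 15 ^ n / unitVol n) * (2 * unitVol n * schurConst n β) with hD
  have hD0 : 0 ≤ D := by positivity
  set ε := 1 / (2 * (D + 1)) with hε
  have hε0 : 0 < ε := by positivity
  have hεD : ε * D ≤ 1 / 2 := by
    rw [hε, one_div_mul_eq_div, div_le_div_iff₀ (by positivity) (by norm_num)]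
    linarith
  set K := A * schurConst n β + 1 / (4 * ε) with hK
  have hK0 : 0 ≤ K := by positivity
  refine ⟨2 * (K * ∫ v, |f v|), fun φ hφ J hJ => ?_⟩
  set c : ℕ × ℕ → ℝ := fun i => convPhi f (φ i) (scale i.2) (cellCenter i) with hc
  have hcA : ∀ i ∈ J, |c i| ≤ A := by
    intro i hi
    obtain ⟨x, hx, hxi⟩ := hJ i hi
    have hs := scale_pos i.2
    refine (abs_convPhi_le hβ hβ1 (hφ i) hs _ hf.locallyIntegrable).trans ?_
    have h1 : ∫ v in closedBall (cellCenter i) (scale i.2), |f v| ≤ N * (2 * scale i.2) ^ n := by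
      refine le_trans ?_ (hF x hx (2 * scale i.2) (by positivity))
      refine setIntegral_mono_set hf.abs.integrableOn
        (Filter.Eventually.of_forall fun _ => abs_nonneg _)
        (LE.le.eventuallyLE fun u hu => ?_)
      have : dist u (cellCenter i) ≤ scale i.2 := hu
      exact mem_ball.2 (by linarith [dist_triangle u (cellCenter i) x])
    refine (mul_le_mul_of_nonneg_left h1 (by positivity)).trans_eq ?_
    rw [hA, mul_pow]
    linear_combination (2 * N * 2 ^ n) * rpow_neg_mul_pow (n := n) hs
  set h := superpos φ c J with hh
  set X := ∑ i ∈ J, volume.real (cell i : Set (Rn n)) * c i ^ 2 with hX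
  have hX0 : 0 ≤ X := Finset.sum_nonneg fun i _ => mul_nonneg measureReal_nonneg (sq_nonneg _)
  have hcont : Continuous h := superpos_continuous hβ hφ c J
  have hXint : X = ∫ u, f u * h u := by
    simp_rw [hh, superpos, Finset.mul_sum]
    have hint : ∀ i, Integrable fun u => f u * (volume.real (cell i : Set (Rn n)) * c i *
        bump (φ i) (scale i.2) (cellCenter i) u) := fun i => by
      simpa [mul_left_comm] using (mul_bump_integrable hβ (hφ i) (scale_pos i.2) (cellCenter i)
        hf.locallyIntegrable).const_mul (volume.real (cell i : Set (Rn n)) * c i)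
    rw [integral_finsetSum _ fun i _ => hint i]
    refine Finset.sum_congr rfl fun i _ => ?_
    simp_rw [mul_left_comm (f _)]
    rw [integral_const_mul, ← convPhi_eq]
    ring
  have hle := lintegral_mul_le hf hF0 hN hF hcont (mul_nonneg hA0 hS.le) hε0
    (fun v v' hv hvv' => abs_superpos_sub_le hβ hφ hJ hcA hA0 hv hvv')
  have hsq := integral_superpos_sq_le hβ hβ1 hφ c J
  rw [← ofReal_integral_norm_eq_lintegral_enorm hf, ← ofReal_integral_eq_lintegral_ofReal
    (superpos_sq_integrable hβ hφ c J) (Filter.Eventually.of_forall fun _ => sq_nonneg _),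
    ← ENNReal.ofReal_mul hK0, ← ENNReal.ofReal_mul (by positivity),
    ← ENNReal.ofReal_add (mul_nonneg hK0 (integral_nonneg fun _ => norm_nonneg _))
      (mul_nonneg (by positivity) (integral_nonneg fun _ => sq_nonneg _))] at hle
  have hXle : ENNReal.ofReal X ≤ ∫⁻ v, ‖f v‖ₑ * ‖h v‖ₑ := by
    simp_rw [← enorm_mul]
    refine le_trans ?_ (enorm_integral_le_lintegral_enorm _)
    rw [← hXint, Real.enorm_eq_ofReal hX0]
  have h1 := (ENNReal.ofReal_le_ofReal_iff (add_nonneg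
    (mul_nonneg hK0 (integral_nonneg fun _ => norm_nonneg _))
    (mul_nonneg (by positivity) (integral_nonneg fun _ => sq_nonneg _)))).1 (hXle.trans hle)
  simp only [Real.norm_eq_abs] at h1
  have h2 := mul_le_mul_of_nonneg_left hsq
    (by positivity : 0 ≤ 2 * ε * (N * 15 ^ n / unitVol n))
  have h3 : 2 * ε * (N * 15 ^ n / unitVol n) * (2 * unitVol n * schurConst n β * X) =
      ε * D * X := by rw [hD]; ring
  have h4 := mul_le_mul_of_nonneg_right hεD hX0
  rw [h3] at h2
  linarith

/-! ### Almost everywhere square summability at small scales -/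

lemma ae_exists_setIntegral_ball_le {f : Rn n → ℝ} (hf : Integrable f) :
    ∀ᵐ x : Rn n, ∃ N : ℕ, ∀ r > 0, ∫ u in ball x r, |f u| ≤ N * r ^ n := by
  filter_upwards [(Besicovitch.vitaliFamily (volume : Measure (Rn n))).ae_tendsto_average
    hf.abs.locallyIntegrable] with x hx
  have ht := hx.comp (Besicovitch.tendsto_filterAt volume x)
  have hV := unitVol_pos n
  have hev := ht.eventually (gt_mem_nhds (lt_add_one |f x|))
  obtain ⟨r₀, hr₀, hr₀'⟩ := mem_nhdsGT_iff_exists_Ioo_subset.1 hev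
  have hr₀0 : 0 < r₀ := hr₀
  set M := (|f x| + 1) * unitVol n + (∫ u, |f u|) / r₀ ^ n with hM
  have hI : 0 ≤ ∫ u, |f u| := integral_nonneg fun _ => abs_nonneg _
  obtain ⟨N, hN⟩ := exists_nat_ge M
  refine ⟨N, fun r hr => ?_⟩
  suffices h : ∫ u in ball x r, |f u| ≤ M * r ^ n from
    h.trans (mul_le_mul_of_nonneg_right hN (by positivity))
  rcases lt_or_ge r r₀ with h | h
  · have h1 : ⨍ u in closedBall x r, |f u| < |f x| + 1 := hr₀' ⟨hr, h⟩
    have hvol : volume.real (closedBall x r) = unitVol n * r ^ n := by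
      rw [Measure.addHaar_real_closedBall volume x hr.le, finrank_euclideanSpace_fin, mul_comm]
      rfl
    rw [setAverage_eq, hvol, smul_eq_mul, inv_mul_lt_iff₀ (by positivity)] at h1
    have h2 : ∫ u in ball x r, |f u| ≤ ∫ u in closedBall x r, |f u| :=
      setIntegral_mono_set hf.abs.integrableOn
        (Filter.Eventually.of_forall fun _ => abs_nonneg _) ball_subset_closedBall.eventuallyLE
    have h3 : 0 ≤ (∫ u, |f u|) / r₀ ^ n * r ^ n := by positivity
    rw [hM]
    linarith
  · have h2 : ∫ u in ball x r, |f u| ≤ ∫ u, |f u| :=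
      setIntegral_le_integral hf.abs (Filter.Eventually.of_forall fun _ => abs_nonneg _)
    have h3 : ∫ u, |f u| ≤ (∫ u, |f u|) / r₀ ^ n * r ^ n := by
      rw [div_mul_eq_mul_div, le_div_iff₀ (by positivity)]
      gcongr
    have h4 : 0 ≤ (|f x| + 1) * unitVol n * r ^ n := by positivity
    rw [hM]
    linarith

lemma exists_Abeta_le_two_mul (β : ℝ) (f : Rn n → ℝ) (y : Rn n) (t : ℝ) :
    ∃ φ : Rn n → ℝ, MemCbeta β φ ∧ Abeta β f y t ≤ 2 * |convPhi f φ t y| := by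
  have : Nonempty {φ : Rn n → ℝ // MemCbeta β φ} := ⟨⟨0, MemCbeta.zero β⟩⟩
  rcases (Abeta_nonneg β f y t).eq_or_lt with h | h
  · exact ⟨0, MemCbeta.zero β, by rw [← h]; positivity⟩
  · obtain ⟨⟨φ, hφ⟩, h'⟩ := exists_lt_of_lt_ciSup (half_lt_self h)
    have : Abeta β f y t / 2 < |convPhi f φ t y| := h'
    exact ⟨φ, hφ, by linarith⟩

lemma ae_tsum_Abeta_lt_top_of_mem {β : ℝ} (hβ : 0 < β) (hβ1 : β ≤ 1) {f : Rn n → ℝ}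
    (hf : Integrable f) {F : Set (Rn n)} {N : ℝ} (hN : 0 ≤ N)
    (hF : ∀ x ∈ F, ∀ r > 0, ∫ u in ball x r, |f u| ≤ N * r ^ n) :
    ∀ᵐ x : Rn n, x ∈ F → ∑' k : ℕ, ENNReal.ofReal (Abeta β f x ((1 / 2) ^ k) ^ 2) < ⊤ := by
  classical
  rcases F.eq_empty_or_nonempty with rfl | hF0
  · simp
  choose φ hφ hφA using fun i : ℕ × ℕ =>
    exists_Abeta_le_two_mul β f (cellCenter i) (scale i.2)
  obtain ⟨C, hC⟩ := exists_sum_convPhi_sq_le hβ hβ1 hf hF0 hN hF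
  set I : Set (ℕ × ℕ) := {i | ∃ x ∈ F, dist (cellCenter i) x < scale i.2 / 2} with hI
  set a : ℕ × ℕ → ENNReal := fun i =>
    if i ∈ I then ENNReal.ofReal (Abeta β f (cellCenter i) (scale i.2) ^ 2) else 0 with ha
  have hfin : ∫⁻ x : Rn n, ∑' i, (cell i).indicator (fun _ => a i) x ≠ ⊤ := by
    rw [lintegral_tsum fun i => (measurable_const.indicator (measurableSet_cell i)).aemeasurable]
    simp_rw [lintegral_indicator (measurableSet_cell _), setLIntegral_const]
    refine ne_top_of_le_ne_top (ENNReal.ofReal_ne_top (r := 4 * C)) ?_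
    rw [ENNReal.tsum_eq_iSup_sum]
    refine iSup_le fun J => ?_
    calc ∑ i ∈ J, a i * volume (cell i : Set (Rn n))
        = ∑ i ∈ J with i ∈ I, ENNReal.ofReal (volume.real (cell i : Set (Rn n)) *
            Abeta β f (cellCenter i) (scale i.2) ^ 2) := by
          rw [Finset.sum_filter]
          refine Finset.sum_congr rfl fun i _ => ?_
          simp only [ha]
          split_ifs
          · rw [ENNReal.ofReal_mul measureReal_nonneg, ofReal_measureReal (volume_cell_ne_top i),
              mul_comm]
          · exact zero_mul _
      _ = ENNReal.ofReal (∑ i ∈ J with i ∈ I, volume.real (cell i : Set (Rn n)) *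
            Abeta β f (cellCenter i) (scale i.2) ^ 2) :=
          (ENNReal.ofReal_sum_of_nonneg fun i _ =>
            mul_nonneg measureReal_nonneg (sq_nonneg _)).symm
      _ ≤ _ := by
          refine ENNReal.ofReal_le_ofReal ?_
          refine le_trans ?_ (mul_le_mul_of_nonneg_left (hC φ hφ {i ∈ J | i ∈ I}
            fun i hi => (Finset.mem_filter.1 hi).2) (by norm_num))
          rw [Finset.mul_sum]
          refine Finset.sum_le_sum fun i _ => ?_
          have h1 := pow_le_pow_left₀ (Abeta_nonneg β f _ _) (hφA i) 2
          rw [mul_pow, sq_abs] at h1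
          have h2 := mul_le_mul_of_nonneg_left h1
            (measureReal_nonneg (μ := volume) (s := (cell i : Set (Rn n))))
          linarith
  have hmeas : Measurable fun x : Rn n => ∑' i, (cell i).indicator (fun _ => a i) x :=
    Measurable.tsum fun i => measurable_const.indicator (measurableSet_cell i)
  filter_upwards [ae_lt_top hmeas hfin] with x hx hxF
  choose p hp using exists_mem_cell x
  have hle : ∑' k : ℕ, ENNReal.ofReal (Abeta β f x ((1 / 2) ^ k) ^ 2) ≤
      ∑' k : ℕ, ENNReal.ofReal (((2 : ℝ) ^ ((n : ℝ) + β)) ^ 2) *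
        (cell (p k, k)).indicator (fun _ => a (p k, k)) x := by
    refine ENNReal.tsum_le_tsum fun k => ?_
    have hd := dist_center_lt (hp k)
    have hkI : (p k, k) ∈ I := ⟨x, hxF, by rw [dist_comm]; exact hd⟩
    rw [indicator_of_mem (hp k), ha]
    simp only [hkI, if_true]
    rw [← ENNReal.ofReal_mul (by positivity), ← mul_pow]
    refine ENNReal.ofReal_le_ofReal (pow_le_pow_left₀ (Abeta_nonneg β f _ _) ?_ 2)
    refine Abeta_le hβ hβ1 hf.locallyIntegrable (by positivity) ?_ ?_
    · have := half_pow_eq_scale k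
      simp only at hd
      linarith
    · exact le_rfl
  refine hle.trans_lt ?_
  rw [ENNReal.tsum_mul_left]
  refine ENNReal.mul_lt_top ENNReal.ofReal_lt_top (lt_of_le_of_lt ?_ hx)
  exact ENNReal.tsum_comp_le_tsum_of_injective (f := fun k => (p k, k))
    (fun k k' h => (Prod.ext_iff.1 h).2) fun i => (cell i).indicator (fun _ => a i) x

lemma ae_tsum_Abeta_lt_top_of_integrable {β : ℝ} (hβ : 0 < β) (hβ1 : β ≤ 1) {f : Rn n → ℝ}
    (hf : Integrable f) :
    ∀ᵐ x : Rn n, ∑' k : ℕ, ENNReal.ofReal (Abeta β f x ((1 / 2) ^ k) ^ 2) < ⊤ := by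
  have h := ae_all_iff.2 fun N : ℕ => ae_tsum_Abeta_lt_top_of_mem hβ hβ1 hf
    (F := {x | ∀ r > 0, ∫ u in ball x r, |f u| ≤ N * r ^ n}) N.cast_nonneg fun x hx => hx
  filter_upwards [h, ae_exists_setIntegral_ball_le hf] with x hx ⟨N, hN⟩
  exact hx N hN

lemma Abeta_congr {β : ℝ} {f g : Rn n → ℝ} {y : Rn n} {t : ℝ} (ht : 0 < t)
    (hfg : ∀ u, dist u y ≤ t → f u = g u) : Abeta β f y t = Abeta β g y t := by
  unfold Abeta
  congr 1
  ext ⟨φ, hφ⟩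
  simp only [convPhi_eq]
  congr 2
  ext u
  by_cases hu : bump φ t y u = 0
  · simp [hu]
  · rw [hfg u (bump_support hφ ht hu)]

lemma ae_tsum_Abeta_lt_top {β : ℝ} (hβ : 0 < β) (hβ1 : β ≤ 1) {f : Rn n → ℝ}
    (hf : LocallyIntegrable f) :
    ∀ᵐ x : Rn n, ∑' k : ℕ, ENNReal.ofReal (Abeta β f x ((1 / 2) ^ k) ^ 2) < ⊤ := by
  have h := ae_all_iff.2 fun R : ℕ => ae_tsum_Abeta_lt_top_of_integrable hβ hβ1
    ((hf.integrableOn_isCompact (isCompact_closedBall (0 : Rn n) R)).integrable_indicator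
      measurableSet_closedBall)
  filter_upwards [h] with x hx
  obtain ⟨R, hR⟩ := exists_nat_ge (dist x 0 + 1)
  have e : ∀ k : ℕ, Abeta β f x ((1 / 2) ^ k) =
      Abeta β ((closedBall (0 : Rn n) R).indicator f) x ((1 / 2) ^ k) := fun k => by
    refine Abeta_congr (by positivity) fun u hu => ?_
    have h1 : (1 / 2 : ℝ) ^ k ≤ 1 := pow_le_one₀ (by norm_num) (by norm_num)
    exact (indicator_of_mem (mem_closedBall.2 (by linarith [dist_triangle u x 0])) f).symm
  simp_rw [e]
  exact hx R

/-! ### Finiteness of the area integral -/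

/-- The cone of aperture `γ` at `x`. -/
def cone (γ : ℝ) (x : Rn n) : Set (Rn n × ℝ) := {p | dist x p.1 < γ * p.2 ∧ 0 < p.2}

/-- The square of the intrinsic area function, with values in `[0, ∞]`. -/
def areaSq (β : ℝ) (f : Rn n → ℝ) (γ : ℝ) (x : Rn n) : ENNReal :=
  ∫⁻ p in cone γ x, ENNReal.ofReal (Abeta β f p.1 p.2 ^ 2 / p.2 ^ (n + 1))

/-- The square sum of the values of `Abeta` over the dyadic scales. -/
def dyadicSq (β : ℝ) (f : Rn n → ℝ) (x : Rn n) : ENNReal :=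
  ∑' k : ℤ, ENNReal.ofReal (Abeta β f x ((2 : ℝ) ^ k) ^ 2)

lemma volume_ball_prod_Ico (x : Rn n) {r : ℝ} (hr : 0 < r) (a b : ℝ) :
    volume (ball x r ×ˢ Ico a b) = ENNReal.ofReal (unitVol n * r ^ n * (b - a)) := by
  rw [Measure.volume_eq_prod, Measure.prod_prod, volume_ball_eq x hr, Real.volume_Ico,
    ENNReal.ofReal_mul (mul_nonneg (unitVol_pos n).le (by positivity))]

lemma exists_areaSq_le_dyadicSq {β : ℝ} (hβ : 0 < β) (hβ1 : β ≤ 1) {f : Rn n → ℝ}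
    (hf : LocallyIntegrable f) (j : ℕ) (x : Rn n) :
    ∃ C : ℝ, areaSq β f ((2 : ℝ) ^ j) x ≤ ENNReal.ofReal C * dyadicSq β f x := by
  have hV := unitVol_pos n
  set K : ℝ := ((2 : ℝ) ^ (j + 2)) ^ ((n : ℝ) + β) with hK
  have hK0 : 0 ≤ K := by positivity
  set s : ℤ → Set (Rn n × ℝ) := fun k =>
    ball x ((2 : ℝ) ^ (j + 1) * (2 : ℝ) ^ k) ×ˢ Ico ((2 : ℝ) ^ k) ((2 : ℝ) ^ (k + 1)) with hs
  set C := K ^ 2 * (unitVol n * (2 ^ (j + 1)) ^ n) with hC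
  have hC0 : 0 ≤ C := by positivity
  have hcov : cone ((2 : ℝ) ^ j) x ⊆ ⋃ k, s k := by
    rintro ⟨y, t⟩ ⟨h1, h2⟩
    obtain ⟨k, hk⟩ := exists_mem_Ico_zpow (h2 : 0 < t) (one_lt_two (α := ℝ))
    refine mem_iUnion.2 ⟨k, mem_prod.2 ⟨?_, hk⟩⟩
    have h3 := hk.2
    rw [zpow_add_one₀ two_ne_zero] at h3
    rw [mem_ball, dist_comm]
    refine lt_trans h1 ?_
    calc (2 : ℝ) ^ j * t < 2 ^ j * (2 ^ k * 2) := by gcongr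
      _ = _ := by ring
  have hslab : ∀ k, ∫⁻ p in s k, ENNReal.ofReal (Abeta β f p.1 p.2 ^ 2 / p.2 ^ (n + 1)) ≤
      ENNReal.ofReal C *
        ENNReal.ofReal (Abeta β f x ((2 : ℝ) ^ (k + (j + 2 : ℤ))) ^ 2) := by
    intro k
    have h2k : (0 : ℝ) < 2 ^ k := by positivity
    have hkj : (2 : ℝ) ^ (k + (j + 2 : ℤ)) = 2 ^ (j + 2) * 2 ^ k := by
      rw [zpow_add₀ two_ne_zero, mul_comm]
      norm_cast
    set D := Abeta β f x ((2 : ℝ) ^ (k + (j + 2 : ℤ))) with hD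
    have hpt : ∀ p ∈ s k, ENNReal.ofReal (Abeta β f p.1 p.2 ^ 2 / p.2 ^ (n + 1)) ≤
        ENNReal.ofReal ((K * D) ^ 2 / ((2 : ℝ) ^ k) ^ (n + 1)) := by
      rintro ⟨y, t⟩ ⟨h1, h2, h3⟩
      simp only [mem_ball] at h1 h2 h3 ⊢
      have ht : 0 < t := h2k.trans_le h2
      have hA : Abeta β f y t ≤ K * D := by
        refine Abeta_le hβ hβ1 hf ht ?_ ?_
        · rw [zpow_add_one₀ two_ne_zero] at h3
          rw [hkj]
          have h4 : (2 : ℝ) ^ k * 1 ≤ 2 ^ k * 2 ^ j := by gcongr; exact one_le_pow₀ (by norm_num)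
          rw [pow_succ] at h1
          rw [pow_add]
          linarith
        · rw [hkj]
          gcongr
      have hA0 := Abeta_nonneg β f y t
      gcongr
    refine (setLIntegral_mono' (measurableSet_ball.prod measurableSet_Ico) hpt).trans ?_
    rw [setLIntegral_const, volume_ball_prod_Ico x (by positivity),
      ← ENNReal.ofReal_mul (by positivity), ← ENNReal.ofReal_mul hC0]
    refine (congrArg ENNReal.ofReal ?_).le
    rw [zpow_add_one₀ two_ne_zero, hC, mul_pow, mul_pow, pow_succ ((2 : ℝ) ^ k)]
    field_simp
    ring
  refine ⟨C, ((lintegral_mono_set hcov).trans (lintegral_iUnion_le _ _)).trans ?_⟩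
  refine (ENNReal.tsum_le_tsum hslab).trans ?_
  rw [ENNReal.tsum_mul_left]
  exact (congrArg _ ((Equiv.addRight (j + 2 : ℤ)).tsum_eq
    fun k => ENNReal.ofReal (Abeta β f x ((2 : ℝ) ^ k) ^ 2))).le

lemma exists_dyadicSq_le_areaSq {β : ℝ} (hβ : 0 < β) (hβ1 : β ≤ 1) {f : Rn n → ℝ}
    (hf : LocallyIntegrable f) (x : Rn n) :
    ∃ C : ℝ, dyadicSq β f x ≤ ENNReal.ofReal C * areaSq β f 1 x := by
  have hV := unitVol_pos n
  set K : ℝ := (4 : ℝ) ^ ((n : ℝ) + β) with hK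
  have hK0 : 0 < K := by positivity
  set s : ℤ → Set (Rn n × ℝ) := fun k =>
    ball x ((2 : ℝ) ^ k) ×ˢ Ico ((2 : ℝ) ^ (k + 1)) ((2 : ℝ) ^ (k + 1 + 1)) with hs
  have hms : ∀ k, MeasurableSet (s k) := fun k => measurableSet_ball.prod measurableSet_Ico
  set C := K ^ 2 * 4 ^ (n + 1) / (2 * unitVol n) with hC
  have hC0 : 0 ≤ C := by positivity
  have hsub : ⋃ k, s k ⊆ cone 1 x := by
    refine iUnion_subset fun k => ?_
    rintro ⟨y, t⟩ ⟨h1, h2, h3⟩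
    simp only [mem_ball] at h1 h2 h3
    have h2k : (0 : ℝ) < 2 ^ k := by positivity
    rw [zpow_add_one₀ two_ne_zero] at h2
    refine ⟨?_, ?_⟩
    · simp only
      rw [dist_comm]
      linarith
    · simp only
      linarith
  have hdisj : Pairwise (Function.onFun Disjoint s) := by
    intro k k' hkk'
    refine disjoint_left.2 ?_
    rintro ⟨y, t⟩ ⟨_, h2, h3⟩ ⟨_, h2', h3'⟩
    simp only at h2 h3 h2' h3'
    have h4 := (zpow_lt_zpow_iff_right₀ (one_lt_two (α := ℝ))).1 (h2.trans_lt h3')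
    have h5 := (zpow_lt_zpow_iff_right₀ (one_lt_two (α := ℝ))).1 (h2'.trans_lt h3)
    omega
  have hslab : ∀ k, ENNReal.ofReal (Abeta β f x ((2 : ℝ) ^ k) ^ 2) ≤ ENNReal.ofReal C *
      ∫⁻ p in s k, ENNReal.ofReal (Abeta β f p.1 p.2 ^ 2 / p.2 ^ (n + 1)) := by
    intro k
    have h2k : (0 : ℝ) < 2 ^ k := by positivity
    set D := Abeta β f x ((2 : ℝ) ^ k) with hD
    have hpt : ∀ p ∈ s k, ENNReal.ofReal ((K⁻¹ * D) ^ 2 / (4 * (2 : ℝ) ^ k) ^ (n + 1)) ≤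
        ENNReal.ofReal (Abeta β f p.1 p.2 ^ 2 / p.2 ^ (n + 1)) := by
      rintro ⟨y, t⟩ ⟨h1, h2, h3⟩
      simp only [mem_ball] at h1 h2 h3 ⊢
      rw [zpow_add_one₀ two_ne_zero] at h3
      rw [zpow_add_one₀ two_ne_zero] at h2 h3
      have ht : 0 < t := by linarith
      have ht4 : t ≤ 4 * 2 ^ k := by linarith
      have hA : K⁻¹ * D ≤ Abeta β f y t := by
        rw [inv_mul_le_iff₀ hK0]
        refine Abeta_le hβ hβ1 hf h2k ?_ ht4
        rw [dist_comm]
        linarith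
      have hD0 : 0 ≤ D := Abeta_nonneg β f _ _
      gcongr
    refine le_trans ?_ (mul_le_mul_right (setLIntegral_mono' (hms k) hpt) _)
    rw [setLIntegral_const, volume_ball_prod_Ico x (by positivity),
      ← ENNReal.ofReal_mul (by positivity), ← ENNReal.ofReal_mul hC0]
    refine (congrArg ENNReal.ofReal ?_).le
    rw [zpow_add_one₀ two_ne_zero (k + 1), zpow_add_one₀ two_ne_zero k, hC, mul_pow, mul_pow,
      pow_succ ((2 : ℝ) ^ k)]
    field_simp
    ring
  refine ⟨C, (ENNReal.tsum_le_tsum hslab).trans ?_⟩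
  rw [ENNReal.tsum_mul_left, ← lintegral_iUnion hms hdisj]
  exact mul_le_mul_right (lintegral_mono_set hsub) _

lemma tsum_Abeta_two_pow_lt_top {β : ℝ} (hβ : 0 < β) (hβ1 : β ≤ 1) {f : Rn n → ℝ}
    (hf : LocallyIntegrable f) {x₀ : Rn n} (h₀ : dyadicSq β f x₀ < ⊤) (x : Rn n) :
    ∑' k : ℕ, ENNReal.ofReal (Abeta β f x ((2 : ℝ) ^ k) ^ 2) < ⊤ := by
  obtain ⟨m, hm⟩ := pow_unbounded_of_one_lt (dist x x₀) (one_lt_two (α := ℝ))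
  set K : ℝ := ((2 : ℝ) ^ (m + 1)) ^ ((n : ℝ) + β) with hK
  have hle : ∀ k : ℕ, ENNReal.ofReal (Abeta β f x ((2 : ℝ) ^ k) ^ 2) ≤
      ENNReal.ofReal (K ^ 2) *
        ENNReal.ofReal (Abeta β f x₀ ((2 : ℝ) ^ ((k + (m + 1) : ℕ) : ℤ)) ^ 2) := by
    intro k
    rw [← ENNReal.ofReal_mul (by positivity), ← mul_pow]
    refine ENNReal.ofReal_le_ofReal (pow_le_pow_left₀ (Abeta_nonneg β f _ _) ?_ 2)
    have h1 : (1 : ℝ) ≤ 2 ^ m := one_le_pow₀ (by norm_num)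
    have h2 : (1 : ℝ) ≤ 2 ^ k := one_le_pow₀ (by norm_num)
    rw [zpow_natCast]
    refine Abeta_le hβ hβ1 hf (by positivity) ?_ ?_
    · rw [pow_add, pow_succ]
      nlinarith
    · rw [pow_add, mul_comm]
  refine (ENNReal.tsum_le_tsum hle).trans_lt ?_
  rw [ENNReal.tsum_mul_left]
  refine ENNReal.mul_lt_top ENNReal.ofReal_lt_top (lt_of_le_of_lt ?_ h₀)
  refine ENNReal.tsum_comp_le_tsum_of_injective (f := fun k : ℕ => ((k + (m + 1) : ℕ) : ℤ))
    (fun k k' h => ?_) fun k : ℤ => ENNReal.ofReal (Abeta β f x₀ ((2 : ℝ) ^ k) ^ 2)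
  simp only at h
  omega

lemma ae_areaSq_lt_top {β : ℝ} (hβ : 0 < β) (hβ1 : β ≤ 1) {f : Rn n → ℝ}
    (hf : LocallyIntegrable f) {x₀ : Rn n} (h₀ : areaSq β f 1 x₀ < ⊤) :
    ∀ᵐ x : Rn n, ∀ j : ℕ, areaSq β f ((2 : ℝ) ^ j) x < ⊤ := by
  obtain ⟨C₀, hC₀⟩ := exists_dyadicSq_le_areaSq hβ hβ1 hf x₀
  have hd₀ : dyadicSq β f x₀ < ⊤ := hC₀.trans_lt (ENNReal.mul_lt_top ENNReal.ofReal_lt_top h₀)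
  filter_upwards [ae_tsum_Abeta_lt_top hβ hβ1 hf] with x hx j
  obtain ⟨C, hC⟩ := exists_areaSq_le_dyadicSq hβ hβ1 hf j x
  refine hC.trans_lt (ENNReal.mul_lt_top ENNReal.ofReal_lt_top ?_)
  have hsum := HasSum.of_nat_of_neg_add_one
    (f := fun k : ℤ => ENNReal.ofReal (Abeta β f x ((2 : ℝ) ^ k) ^ 2))
    ENNReal.summable.hasSum ENNReal.summable.hasSum
  rw [dyadicSq, hsum.tsum_eq]
  refine ENNReal.add_lt_top.2 ⟨?_, ?_⟩
  · simpa only [zpow_natCast] using tsum_Abeta_two_pow_lt_top hβ hβ1 hf hd₀ x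
  · refine lt_of_le_of_lt ?_ hx
    have e : ∀ k : ℕ, (2 : ℝ) ^ (-((k : ℤ) + 1)) = (1 / 2) ^ (k + 1) := fun k => by
      rw [zpow_neg, one_div, inv_pow]
      norm_cast
    simp_rw [e]
    exact ENNReal.tsum_comp_le_tsum_of_injective (add_left_injective 1)
      fun k : ℕ => ENNReal.ofReal (Abeta β f x ((1 / 2) ^ k) ^ 2)

/-! ### Measurability of the intrinsic averaging function -/

lemma continuousOn_convPhi {β : ℝ} (hβ : 0 < β) (hβ1 : β ≤ 1) {f : Rn n → ℝ}
    (hf : LocallyIntegrable f) {φ : Rn n → ℝ} (hφ : MemCbeta β φ) :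
    ContinuousOn (fun p : Rn n × ℝ => convPhi f φ p.2 p.1) {p | 0 < p.2} := by
  rintro ⟨y₀, t₀⟩ (ht₀ : 0 < t₀)
  refine ContinuousAt.continuousWithinAt ?_
  have hnhds : ∀ᶠ p : Rn n × ℝ in nhds (y₀, t₀),
      dist p.1 y₀ < 1 ∧ t₀ / 2 < p.2 ∧ p.2 < 2 * t₀ := by
    refine IsOpen.mem_nhds ?_ ⟨by simp, by simp only; linarith, by simp only; linarith⟩
    exact (isOpen_lt (continuous_fst.dist continuous_const) continuous_const).inter
      ((isOpen_lt continuous_const continuous_snd).inter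
        (isOpen_lt continuous_snd continuous_const))
  simp_rw [convPhi_eq]
  refine continuousAt_of_dominated (bound := fun u => 2 * (t₀ / 2) ^ (-(n : ℝ)) *
    (closedBall y₀ (1 + 2 * t₀)).indicator (fun v => |f v|) u) ?_ ?_ ?_ ?_
  · filter_upwards [hnhds] with p hp
    exact (mul_bump_integrable hβ hφ (by linarith [hp.2.1]) p.1 hf).aestronglyMeasurable
  · filter_upwards [hnhds] with p hp
    refine Filter.Eventually.of_forall fun u => ?_
    have hp2 : 0 < p.2 := by linarith [hp.2.1]
    refine (abs_mul_bump_le hβ hβ1 hφ hp2 p.1 f u).trans ?_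
    refine mul_le_mul ?_ ?_ (indicator_nonneg (fun _ _ => abs_nonneg _) _) (by positivity)
    · exact mul_le_mul_of_nonneg_left (Real.rpow_le_rpow_of_nonpos (by positivity) hp.2.1.le
        (by simp)) zero_le_two
    · exact indicator_le_indicator_of_subset (closedBall_subset_closedBall' (by linarith))
        (fun _ => abs_nonneg _) u
  · exact (LocallyIntegrable.indicator_abs_integrable hf _ _).const_mul _
  · refine Filter.Eventually.of_forall fun u => ?_
    refine continuousAt_const.mul (ContinuousAt.mul ?_ ?_)
    · exact continuousAt_snd.rpow_const (Or.inl ht₀.ne')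
    · refine (hφ.continuous hβ).continuousAt.comp ?_
      exact (continuousAt_snd.inv₀ ht₀.ne').smul (continuousAt_fst.sub continuousAt_const)

lemma measurable_indicator_Abeta {β : ℝ} (hβ : 0 < β) (hβ1 : β ≤ 1) {f : Rn n → ℝ}
    (hf : LocallyIntegrable f) :
    Measurable ({p : Rn n × ℝ | 0 < p.2}.indicator fun p => Abeta β f p.1 p.2) := by
  have : Nonempty {φ : Rn n → ℝ // MemCbeta β φ} := ⟨⟨0, MemCbeta.zero β⟩⟩
  have hopen : IsOpen {p : Rn n × ℝ | 0 < p.2} := isOpen_lt continuous_const continuous_snd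
  refine measurable_of_Ioi fun a => ?_
  rcases lt_or_ge a 0 with ha | ha
  · convert MeasurableSet.univ
    refine eq_univ_of_forall fun p => ?_
    exact ha.trans_le (indicator_nonneg (fun _ _ => Abeta_nonneg β f _ _) p)
  · have e : ({p : Rn n × ℝ | 0 < p.2}.indicator fun p => Abeta β f p.1 p.2) ⁻¹' Ioi a =
        ⋃ φ : {φ : Rn n → ℝ // MemCbeta β φ},
          {p : Rn n × ℝ | 0 < p.2} ∩ (fun p => |convPhi f φ.1 p.2 p.1|) ⁻¹' Ioi a := by
      ext p
      by_cases hp : 0 < p.2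
      · simp only [mem_preimage, indicator, mem_ofPred_eq, hp, if_true, mem_Ioi, mem_iUnion,
          mem_inter_iff, true_and]
        exact lt_ciSup_iff (Abeta_bddAbove hβ hβ1 hf p.1 hp)
      · simp [indicator, hp, ha]
    rw [e]
    exact (isOpen_iUnion fun φ => (continuousOn_convPhi hβ hβ1 hf φ.2).abs.isOpen_inter_preimage
      hopen isOpen_Ioi).measurableSet

/-- The measure `(A_β f)² t^{-n-1} dy dt` has this density on `Rn n × ℝ`. -/
def areaDensity (β : ℝ) (f : Rn n → ℝ) : Rn n × ℝ → ENNReal :=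
  {p : Rn n × ℝ | 0 < p.2}.indicator
    fun p => ENNReal.ofReal (Abeta β f p.1 p.2 ^ 2 / p.2 ^ (n + 1))

lemma measurable_areaDensity {β : ℝ} (hβ : 0 < β) (hβ1 : β ≤ 1) {f : Rn n → ℝ}
    (hf : LocallyIntegrable f) : Measurable (areaDensity β f) := by
  have e : areaDensity β f = fun p : Rn n × ℝ => ENNReal.ofReal
      (({p : Rn n × ℝ | 0 < p.2}.indicator fun p => Abeta β f p.1 p.2) p ^ 2 /
        p.2 ^ (n + 1)) := by
    ext p
    by_cases hp : 0 < p.2 <;> simp [areaDensity, indicator, hp]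
  rw [e]
  exact (((measurable_indicator_Abeta hβ hβ1 hf).pow_const 2).div
    (measurable_snd.pow_const (n + 1))).ennreal_ofReal

lemma measurableSet_cone (γ : ℝ) (x : Rn n) : MeasurableSet (cone γ x) :=
  (measurableSet_lt (measurable_const.dist measurable_fst) (measurable_snd.const_mul γ)).inter
    (measurableSet_lt measurable_const measurable_snd)

lemma areaSq_eq_lintegral (β γ : ℝ) (f : Rn n → ℝ) (x : Rn n) :
    areaSq β f γ x =
      ∫⁻ p, areaDensity β f p * (ball p.1 (γ * p.2)).indicator (fun _ => 1) x := by
  rw [areaSq, ← lintegral_indicator (measurableSet_cone γ x)]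
  congr 1
  ext p
  by_cases h1 : 0 < p.2 <;> by_cases h2 : dist x p.1 < γ * p.2 <;>
    simp [areaDensity, indicator, cone, h1, h2]

lemma measurable_areaKernel {β : ℝ} (hβ : 0 < β) (hβ1 : β ≤ 1) {f : Rn n → ℝ}
    (hf : LocallyIntegrable f) (γ : ℝ) :
    Measurable fun q : Rn n × (Rn n × ℝ) =>
      areaDensity β f q.2 * (ball q.2.1 (γ * q.2.2)).indicator (fun _ => (1 : ENNReal)) q.1 := by
  refine ((measurable_areaDensity hβ hβ1 hf).comp measurable_snd).mul ?_
  exact measurable_const.indicator (s := {q : Rn n × (Rn n × ℝ) | dist q.1 q.2.1 < γ * q.2.2})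
    (measurableSet_lt (by fun_prop) (by fun_prop))

lemma measurable_areaSq {β : ℝ} (hβ : 0 < β) (hβ1 : β ≤ 1) {f : Rn n → ℝ}
    (hf : LocallyIntegrable f) (γ : ℝ) : Measurable (areaSq β f γ) := by
  rw [funext (areaSq_eq_lintegral β γ f)]
  exact (measurable_areaKernel hβ hβ1 hf γ).lintegral_prod_right'

lemma areaSq_mono (β : ℝ) (f : Rn n → ℝ) {γ γ' : ℝ} (h : γ ≤ γ') (x : Rn n) :
    areaSq β f γ x ≤ areaSq β f γ' x :=
  lintegral_mono_set fun _ hp => ⟨hp.1.trans_le (mul_le_mul_of_nonneg_right h hp.2.le), hp.2⟩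

lemma lintegral_areaSq {β : ℝ} (hβ : 0 < β) (hβ1 : β ≤ 1) {f : Rn n → ℝ}
    (hf : LocallyIntegrable f) (γ : ℝ) (μ : Measure (Rn n)) [SFinite μ] :
    ∫⁻ x, areaSq β f γ x ∂μ = ∫⁻ p, areaDensity β f p * μ (ball p.1 (γ * p.2)) := by
  simp_rw [areaSq_eq_lintegral]
  rw [lintegral_lintegral_swap (measurable_areaKernel hβ hβ1 hf γ).aemeasurable]
  congr 1
  ext p
  rw [lintegral_const_mul _ (measurable_const.indicator measurableSet_ball),
    lintegral_indicator measurableSet_ball, setLIntegral_const, one_mul]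

lemma SbetaA_eq {β : ℝ} (hβ : 0 < β) (hβ1 : β ≤ 1) {f : Rn n → ℝ}
    (hf : LocallyIntegrable f) (γ : ℝ) (x : Rn n) :
    SbetaA β γ f x = (areaSq β f γ x).toReal ^ (1 / 2 : ℝ) := by
  change (∫ p in cone γ x, (Abeta β f p.1 p.2) ^ 2 / p.2 ^ (n + 1)) ^ (1 / 2 : ℝ) = _
  rw [integral_eq_lintegral_of_nonneg_ae, areaSq]
  · filter_upwards [ae_restrict_mem (measurableSet_cone γ x)] with p hp
    have := hp.2
    simp only [Pi.zero_apply]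
    positivity
  · refine (((measurable_indicator_Abeta hβ hβ1 hf).pow_const 2).div
      (measurable_snd.pow_const (n + 1))).aestronglyMeasurable.congr ?_
    filter_upwards [ae_restrict_mem (measurableSet_cone γ x)] with p hp
    have := hp.2
    simp [indicator, this]

/-! ### Weighted estimates -/

/-- The measure `w(x) dx`. -/
def weightMeasure (w : Rn n → ℝ) : Measure (Rn n) :=
  volume.withDensity fun x => ENNReal.ofReal (w x)

instance (w : Rn n → ℝ) : SFinite (weightMeasure w) := by
  unfold weightMeasure; infer_instance

lemma IsA1.weightMeasure_ball {w : Rn n → ℝ} {C : ℝ} (hw : IsA1 w C) (x : Rn n) (r : ℝ) :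
    weightMeasure w (ball x r) = ENNReal.ofReal (∫ u in ball x r, w u) := by
  rw [weightMeasure, withDensity_apply _ measurableSet_ball, ofReal_integral_eq_lintegral_ofReal]
  · exact (hw.2.1.integrableOn_isCompact (isCompact_closedBall x r)).mono_set
      ball_subset_closedBall
  · exact Filter.Eventually.of_forall hw.1

lemma IsA1.weightMeasure_ball_le {w : Rn n → ℝ} {C : ℝ} (hw : IsA1 w C) {γ : ℝ} (hγ : 1 ≤ γ)
    (x : Rn n) {r : ℝ} (hr : 0 < r) :
    weightMeasure w (ball x (γ * r)) ≤
      ENNReal.ofReal (|C| * γ ^ n) * weightMeasure w (ball x r) := by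
  have hV := unitVol_pos n
  have hγ0 : 0 < γ := by linarith
  have hγr : 0 < γ * r := by positivity
  set m := essInf w (volume.restrict (ball x (γ * r))) with hm
  have hm0 : 0 ≤ m := by
    rw [hm, essInf, Filter.liminf_eq]
    have h0 : ∀ᵐ u ∂volume.restrict (ball x (γ * r)), 0 ≤ w u := Filter.Eventually.of_forall hw.1
    exact Real.sSup_nonneg' ⟨0, h0, le_rfl⟩
  have hsub : ball x r ⊆ ball x (γ * r) := ball_subset_ball (by nlinarith)
  have hmw : ∀ᵐ u ∂volume.restrict (ball x r), m ≤ w u :=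
    ae_restrict_of_ae_restrict_of_subset hsub
      (ae_essInf_le (Filter.isBoundedUnder_of ⟨0, hw.1⟩))
  have hint : IntegrableOn w (ball x r) :=
    (hw.2.1.integrableOn_isCompact (isCompact_closedBall x r)).mono_set ball_subset_closedBall
  have h1 : unitVol n * r ^ n * m ≤ ∫ u in ball x r, w u := by
    have := setIntegral_mono_ae_restrict (integrableOn_const measure_ball_lt_top.ne) hint hmw
    rwa [setIntegral_const, volume_real_ball_eq x hr, smul_eq_mul] at this
  have h2 := hw.2.2 x _ hγr
  change _ ≤ C * volume.real (ball x (γ * r)) * m at h2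
  rw [volume_real_ball_eq x hγr, mul_pow] at h2
  rw [hw.weightMeasure_ball, hw.weightMeasure_ball, ← ENNReal.ofReal_mul (by positivity)]
  refine ENNReal.ofReal_le_ofReal (h2.trans ?_)
  calc C * (unitVol n * (γ ^ n * r ^ n)) * m = C * (γ ^ n * (unitVol n * r ^ n * m)) := by ring
    _ ≤ |C| * (γ ^ n * (unitVol n * r ^ n * m)) := by gcongr; exact le_abs_self C
    _ ≤ |C| * (γ ^ n * ∫ u in ball x r, w u) := by gcongr
    _ = _ := by ring

lemma lintegral_areaSq_le {β : ℝ} (hβ : 0 < β) (hβ1 : β ≤ 1) {f : Rn n → ℝ}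
    (hf : LocallyIntegrable f) {w : Rn n → ℝ} {C : ℝ} (hw : IsA1 w C) {γ : ℝ} (hγ : 1 ≤ γ) :
    ∫⁻ x, areaSq β f γ x ∂weightMeasure w ≤
      ENNReal.ofReal (|C| * γ ^ n) * ∫⁻ x, areaSq β f 1 x ∂weightMeasure w := by
  rw [lintegral_areaSq hβ hβ1 hf, lintegral_areaSq hβ hβ1 hf,
    ← lintegral_const_mul' _ _ ENNReal.ofReal_ne_top]
  refine lintegral_mono fun p => ?_
  by_cases hp : 0 < p.2
  · rw [mul_left_comm, one_mul]
    exact mul_le_mul_right (hw.weightMeasure_ball_le hγ p.1 hp) _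
  · simp [areaDensity, indicator, hp]

lemma wLq_two_SbetaA {β : ℝ} (hβ : 0 < β) (hβ1 : β ≤ 1) {f : Rn n → ℝ}
    (hf : LocallyIntegrable f) {w : Rn n → ℝ} {C : ℝ} (hw : IsA1 w C) (γ : ℝ) :
    wLq 2 w (SbetaA β γ f) =
      √(∫⁻ x, ENNReal.ofReal (areaSq β f γ x).toReal ∂weightMeasure w).toReal := by
  have e : ∀ x, |SbetaA β γ f x| ^ (2 : ℝ) = (areaSq β f γ x).toReal := fun x => by
    rw [SbetaA_eq hβ hβ1 hf, ← Real.sqrt_eq_rpow, abs_of_nonneg (Real.sqrt_nonneg _),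
      Real.rpow_two, Real.sq_sqrt ENNReal.toReal_nonneg]
  have hwm : AEMeasurable w := hw.2.1.aestronglyMeasurable.aemeasurable
  have ham := (measurable_areaSq hβ hβ1 hf γ).ennreal_toReal
  rw [wLq, ← Real.sqrt_eq_rpow]
  simp_rw [e]
  rw [integral_eq_lintegral_of_nonneg_ae
    (Filter.Eventually.of_forall fun x => mul_nonneg ENNReal.toReal_nonneg (hw.1 x))
    (ham.aemeasurable.mul hwm).aestronglyMeasurable, weightMeasure,
    lintegral_withDensity_eq_lintegral_mul₀ hwm.ennreal_ofReal ham.ennreal_ofReal.aemeasurable]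
  simp_rw [ENNReal.ofReal_mul ENNReal.toReal_nonneg, Pi.mul_apply, mul_comm]

lemma lintegral_ofReal_areaSq_le {β : ℝ} (hβ : 0 < β) (hβ1 : β ≤ 1) {f : Rn n → ℝ}
    (hf : LocallyIntegrable f) {w : Rn n → ℝ} {C : ℝ} (hw : IsA1 w C) (j : ℕ) :
    (∫⁻ x, ENNReal.ofReal (areaSq β f ((2 : ℝ) ^ j) x).toReal ∂weightMeasure w).toReal ≤
      |C| * ((2 : ℝ) ^ j) ^ n *
        (∫⁻ x, ENNReal.ofReal (areaSq β f 1 x).toReal ∂weightMeasure w).toReal := by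
  have hj : (1 : ℝ) ≤ 2 ^ j := one_le_pow₀ (by norm_num)
  by_cases h : ∃ x₀, areaSq β f 1 x₀ < ⊤
  · obtain ⟨x₀, hx₀⟩ := h
    have hae := (withDensity_absolutelyContinuous volume fun x => ENNReal.ofReal (w x)).ae_le
      (ae_areaSq_lt_top hβ hβ1 hf hx₀)
    have heq : ∀ k : ℕ, ∫⁻ x, ENNReal.ofReal (areaSq β f ((2 : ℝ) ^ k) x).toReal ∂weightMeasure w =
        ∫⁻ x, areaSq β f ((2 : ℝ) ^ k) x ∂weightMeasure w := fun k => by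
      refine lintegral_congr_ae ?_
      filter_upwards [hae] with x hx
      exact ENNReal.ofReal_toReal (hx k).ne
    have h0 := heq 0
    rw [pow_zero] at h0
    rw [heq j, h0]
    by_cases htop : ∫⁻ x, areaSq β f 1 x ∂weightMeasure w = ⊤
    · have : ∫⁻ x, areaSq β f ((2 : ℝ) ^ j) x ∂weightMeasure w = ⊤ :=
        top_le_iff.1 (htop ▸ lintegral_mono fun x => areaSq_mono β f hj x)
      rw [this, htop]
      simp
    · have := ENNReal.toReal_mono (ENNReal.mul_ne_top ENNReal.ofReal_ne_top htop)
        (lintegral_areaSq_le hβ hβ1 hf hw hj)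
      rwa [ENNReal.toReal_mul, ENNReal.toReal_ofReal (by positivity)] at this
  · have htop : ∀ x, areaSq β f ((2 : ℝ) ^ j) x = ⊤ := fun x => by
      refine top_le_iff.1 ((not_lt_top_iff.1 fun hx => h ⟨x, hx⟩).ge.trans ?_)
      exact areaSq_mono β f hj x
    simp only [htop, ENNReal.toReal_top, ENNReal.ofReal_zero, lintegral_zero]
    positivity

/-- aperture comparison in `L²_w`:
`‖S_{β,2^j}(f)‖_{L²_w} ≤ C 2^{jn/2} ‖S_β(f)‖_{L²_w}`. -/
theorem stmt7 (β Cw : ℝ) (hβ : 0 < β) (hβ1 : β ≤ 1) (w : Rn n → ℝ) (hw : IsA1 w Cw) :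
    ∃ C > 0, ∀ (j : ℕ) (f : Rn n → ℝ), MeasureTheory.LocallyIntegrable f →
      wLq 2 w (SbetaA β ((2 : ℝ) ^ j) f) ≤
        C * (2 : ℝ) ^ ((j : ℝ) * (n : ℝ) / 2) * wLq 2 w (SbetaA β 1 f) := by
  refine ⟨√|Cw| + 1, by positivity, fun j f hf => ?_⟩
  rw [wLq_two_SbetaA hβ hβ1 hf hw, wLq_two_SbetaA hβ hβ1 hf hw]
  refine (Real.sqrt_le_sqrt (lintegral_ofReal_areaSq_le hβ hβ1 hf hw j)).trans ?_
  have e : √(((2 : ℝ) ^ j) ^ n) = (2 : ℝ) ^ ((j : ℝ) * (n : ℝ) / 2) := by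
    rw [Real.sqrt_eq_rpow, ← pow_mul, ← Real.rpow_natCast, ← Real.rpow_mul zero_le_two]
    push_cast
    ring_nf
  rw [Real.sqrt_mul (by positivity), Real.sqrt_mul (abs_nonneg _), e]
  gcongr
  linarith
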